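/- arXiv:2306.12529 — 5 statements merged into one kernel-verified Lean document; each statement's English description precedes it below -/
import Mathlib

section
/- Let A be a Banach algebra with a right identity e such that the subalgebra eA = {e·a : a ∈ A} is commutative and semisimple (its Jacobson radical is zero). Then every Jordan derivation d of A is a derivation. -/
/-- The subalgebra `eA = {e * a : a ∈ A}` of a non-unital algebra `A`. -/
def eSub {A : Type*} [NonUnitalNormedRing A] [NormedSpace ℂ A]
    [IsScalarTower ℂ A A] [SMulCommClass ℂ A A] (e : A) : NonUnitalSubalgebra ℂ A where
  carrier := Set.range (fun a => e * a)
  add_mem' := by rintro x y ⟨a, rfl⟩ ⟨b, rfl⟩; exact ⟨a + b, mul_add e a b⟩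
  mul_mem' := by rintro x y ⟨a, rfl⟩ ⟨b, rfl⟩; exact ⟨a * (e * b), (mul_assoc e a (e * b)).symm⟩
  smul_mem' := by rintro c x ⟨a, rfl⟩; exact ⟨c • a, mul_smul_comm c e a⟩
  zero_mem' := ⟨0, mul_zero e⟩

/-- When `e` is a right identity of `A`, the subalgebra `eA` is a unital ring with
identity element `e`. -/
def eRing {A : Type*} [NonUnitalNormedRing A] [NormedSpace ℂ A]
    [IsScalarTower ℂ A A] [SMulCommClass ℂ A A] (e : A) (he : ∀ a : A, a * e = a) :
    Ring (eSub e) :=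
  { (inferInstance : NonUnitalRing (eSub e)) with
    one := ⟨e, e, he e⟩
    one_mul := by
      rintro ⟨x, a, rfl⟩
      ext
      show e * (e * a) = e * a
      rw [← mul_assoc, he e]
    mul_one := by
      rintro ⟨x, a, rfl⟩
      ext
      show (e * a) * e = e * a
      rw [he] }

/-- Let `A` be a complex Banach algebra with a right identity `e` such that
the subalgebra `eA` is commutative and semisimple (its Jacobson radical is zero).  Then every
Jordan derivation `d` of `A` is a derivation. -/
theorem jordanDerivation_is_derivation_of_eA_comm_semisimple
    {A : Type*} [NonUnitalNormedRing A] [NormedSpace ℂ A]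
    [IsScalarTower ℂ A A] [SMulCommClass ℂ A A] [CompleteSpace A]
    (e : A) (he : ∀ a : A, a * e = a)
    (hcomm : ∀ a b : A, (e * a) * (e * b) = (e * b) * (e * a))
    (hss : letI : Ring (eSub e) := eRing e he
           (⊥ : Ideal (eSub e)).jacobson = ⊥)
    (d : A →ₗ[ℂ] A) (hd : ∀ a : A, d (a * a) = d a * a + a * d a) :
    ∀ a x : A, d (a * x) = d a * x + a * d x := by
  have J : ∀ a b : A, d (a * b) + d (b * a) = d a * b + a * d b + (d b * a + b * d a) := by
    intro a b
    have h := hd (a + b)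
    simp only [add_mul, mul_add, map_add, hd a, hd b] at h
    have h2 : d (a * b) + d (b * a) - (d a * b + a * d b + (d b * a + b * d a)) = 0 := by
      rw [← sub_eq_zero] at h
      rw [← h]; abel
    exact sub_eq_zero.mp h2
  -- multiplication by `e` in the middle is invisible
  have mid : ∀ a b : A, a * (e * b) = a * b := by
    intro a b; rw [← mul_assoc, he]
  have C : ∀ a b : A, e * (a * b) = e * (b * a) := by
    intro a b
    have h := hcomm a b
    rwa [mul_assoc, mid, mul_assoc, mid] at h
  have ede : e * d e = 0 := by
    have h := hd e
    rw [he, he] at h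
    exact left_eq_add.mp h
  have ade : ∀ a : A, a * d e = 0 := by
    intro a; rw [← mid, ede, mul_zero]
  have h1 : ∀ a : A, d (e * a) = d e * a + e * d a := by
    intro a
    have h := J a e
    rw [he, he, ade, add_zero] at h
    exact add_left_cancel h
  have h2 : ∀ a b : A, a * d (e * b) = a * d b := by
    intro a b
    rw [h1, mul_add, ← mul_assoc, ade, zero_mul, zero_add, mid]
  have h3 : ∀ a x : A, e * d (x * a) = e * (d x * a) + e * (x * d a) := by
    intro a x
    have hs : e * d (a * x) = e * d (x * a) := by
      rw [← h2 e (a * x), C a x, h2]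
    have h := congrArg (fun t => e * t) (J x a)
    simp only [mul_add] at h
    rw [hs, C (d a) x, C a (d x)] at h
    have h' : (2 : ℂ) • (e * d (x * a)) = (2 : ℂ) • (e * (d x * a) + e * (x * d a)) := by
      rw [two_smul, two_smul, h]; abel
    exact smul_right_injective A (two_ne_zero' ℂ) h'
  intro a x
  have h := J a (e * x)
  rw [mid, h2, mul_assoc, h1 (x * a), h3, h1 x, mid, add_mul, mul_assoc, mul_assoc, mul_assoc] at h
  have h' : d (a * x) - (d a * x + a * d x) = 0 := by
    rw [← sub_eq_zero] at h
    rw [← h]; abel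
  exact sub_eq_zero.mp h'
end

section
/- Let A be a Banach algebra with a right identity e such that the subalgebra eA = {e·a : a ∈ A} is commutative and semisimple (its Jacobson radical is zero). Then every Jordan derivation d of A maps A into the right annihilator ran(A). -/
section JohnsonCore

open Filter Topology

variable {B : Type*} [NormedCommRing B] [NormedAlgebra ℂ B] [CompleteSpace B]

lemma jd_char_cont (φ : B →ₐ[ℂ] ℂ) : Continuous φ := by
  refine AddMonoidHomClass.continuous_of_bound φ ‖(1 : B)‖ fun a => ?_
  rw [mul_comm]
  exact AlgHom.norm_apply_le_self_mul_norm_one φ a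

/-- unbounded functionals take large values on small balls -/
lemma jd_discont (f : B →ₗ[ℂ] ℂ) (hf : ¬ Continuous f) (ε M : ℝ) (hε : 0 < ε) :
    ∃ a, ‖a‖ ≤ ε ∧ M ≤ ‖f a‖ := by
  by_contra! h
  apply hf
  refine AddMonoidHomClass.continuous_of_bound f (M / ε) fun a => ?_
  exact LinearMap.bound_of_ball_bound' hε M f
    (fun z hz => (h z (by simpa using hz)).le) a

/-- Singer-Wermer computation -/
lemma jd_iterate (D : B →ₗ[ℂ] B) (hD : ∀ a b, D (a * b) = a * D b + b * D a) (a : B)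
    (k : ℕ) : ∀ n : ℕ, ∃ y, (D^[k]) (a ^ (n + k)) =
      ((n + k).descFactorial k : B) * a ^ n * (D a) ^ k + a ^ (n + 1) * y := by
  have h1 : D 1 = 0 := by simpa using hD 1 1
  have hnat : ∀ (m : ℕ) (x : B), D ((m : B) * x) = (m : B) * D x := by
    intro m x
    rw [← nsmul_eq_mul, map_nsmul, nsmul_eq_mul]
  have hpow : ∀ n : ℕ, D (a ^ (n + 1)) = ((n + 1 : ℕ) : B) * a ^ n * D a := by
    intro n
    induction n with
    | zero => simp
    | succ n ih => rw [pow_succ, hD, ih]; push_cast; ring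
  induction k with
  | zero => intro n; exact ⟨0, by simp⟩
  | succ k ih =>
    intro n
    obtain ⟨y, hy⟩ := ih (n + 1)
    refine ⟨((n + 1 + k).descFactorial k : B) * D (D a ^ k) + ((n + 1 + 1 : ℕ) : B) * D a * y
      + a * D y, ?_⟩
    have e1 : n + (k + 1) = n + 1 + k := by ring
    rw [e1, Function.iterate_succ_apply', hy, map_add, hD (a ^ (n + 1 + 1)), hpow, mul_assoc,
      hnat, hD (a ^ (n + 1)), hpow, Nat.descFactorial_succ]
    have e2 : n + 1 + k - k = n + 1 := by omega
    rw [e2]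
    push_cast
    ring

lemma jd_singer_wermer (D : B →ₗ[ℂ] B) (hD : ∀ a b, D (a * b) = a * D b + b * D a)
    (hc : Continuous D) (φ : B →ₐ[ℂ] ℂ) (a : B) : φ (D a) = 0 := by
  have h1 : D 1 = 0 := by simpa using hD 1 1
  by_contra hne
  set t := φ (D a) with ht
  obtain ⟨x, hx0, hx1⟩ : ∃ x, φ x = 0 ∧ φ (D x) = 1 := by
    refine ⟨t⁻¹ • (a - φ a • 1), by simp, ?_⟩
    simp [h1, ← ht, hne]
  let T : B →L[ℂ] B := ⟨D, hc⟩
  have hb : ∀ (k : ℕ) (y : B), ‖(D^[k]) y‖ ≤ ‖T‖ ^ k * ‖y‖ := by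
    intro k y
    induction k with
    | zero => simp
    | succ k ih =>
      rw [Function.iterate_succ_apply']
      calc ‖D ((D^[k]) y)‖ ≤ ‖T‖ * ‖(D^[k]) y‖ := T.le_opNorm _
        _ ≤ ‖T‖ * (‖T‖ ^ k * ‖y‖) := by gcongr
        _ = _ := by ring
  have key : ∀ k : ℕ, ((k + 1).factorial : ℝ) ≤ ‖(1 : B)‖ * (‖T‖ * ‖x‖) ^ (k + 1) := by
    intro k
    obtain ⟨y, hy⟩ := jd_iterate D hD x (k + 1) 0
    have := congrArg φ hy
    simp only [zero_add, Nat.descFactorial_self, map_add, map_mul, map_pow, hx0, hx1,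
      map_natCast, pow_zero, one_pow, mul_one, pow_one, zero_mul, add_zero] at this
    have h2 : ‖φ ((D^[k + 1]) (x ^ (k + 1)))‖ = ((k + 1).factorial : ℝ) := by
      rw [this]; simp
    rw [← h2]
    calc _ ≤ ‖(D^[k + 1]) (x ^ (k + 1))‖ * ‖(1 : B)‖ :=
          AlgHom.norm_apply_le_self_mul_norm_one φ _
      _ ≤ (‖T‖ ^ (k + 1) * ‖x‖ ^ (k + 1)) * ‖(1 : B)‖ := by
          gcongr
          refine (hb _ _).trans ?_
          gcongr
          exact norm_pow_le' x (Nat.succ_pos k)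
      _ = _ := by ring
  have hlim := ((FloorSemiring.tendsto_pow_div_factorial_atTop (‖T‖ * ‖x‖)).const_mul
    ‖(1 : B)‖).comp (tendsto_add_atTop_nat 1)
  rw [mul_zero] at hlim
  obtain ⟨k, hk⟩ := (hlim.eventually (gt_mem_nhds zero_lt_one)).exists
  simp only [Function.comp] at hk
  have hpos : (0 : ℝ) < ((k + 1).factorial : ℝ) := by positivity
  rw [← mul_div_assoc, div_lt_one hpos] at hk
  exact absurd (key k) (not_le.mpr hk)

/-- A single element separating countably many characters. -/
lemma jd_separate (φ : ℕ → (B →ₐ[ℂ] ℂ)) (hφ : Function.Injective φ) :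
    ∃ b : B, ∀ i j, i ≠ j → φ i b ≠ φ j b := by
  have hd : Dense (⋂ p : {p : ℕ × ℕ // p.1 ≠ p.2}, {b : B | φ p.1.1 b ≠ φ p.1.2 b}) := by
    refine dense_iInter_of_isOpen (fun p => ?_) (fun p => ?_)
    · exact isOpen_ne_fun (jd_char_cont _) (jd_char_cont _)
    · let S : Submodule ℂ B := LinearMap.ker ((φ p.1.1).toLinearMap - (φ p.1.2).toLinearMap)
      have hS : {b : B | φ p.1.1 b ≠ φ p.1.2 b} = (S : Set B)ᶜ := by
        ext b
        simp [S, sub_eq_zero]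
      rw [hS, ← interior_eq_empty_iff_dense_compl]
      by_contra hne
      have htop := Submodule.eq_top_of_nonempty_interior' S
        (Set.nonempty_iff_ne_empty.mpr hne)
      apply p.2
      apply hφ
      ext b
      have : b ∈ S := by rw [htop]; trivial
      simpa [S, sub_eq_zero] using this
  obtain ⟨b, hb⟩ := hd.nonempty
  refine ⟨b, fun i j hij => ?_⟩
  exact Set.mem_iInter.mp hb ⟨(i, j), hij⟩

lemma jd_prod_norm (b : ℕ → B) (hb : ∀ i, ‖b i‖ ≤ 1) (s : Finset ℕ) :
    ‖∏ i ∈ s, b i‖ ≤ ‖(1 : B)‖ := by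
  induction s using Finset.induction_on with
  | empty => simp
  | insert i s hi ih =>
    rw [Finset.prod_insert hi]
    calc _ ≤ ‖b i‖ * ‖∏ i ∈ s, b i‖ := norm_mul_le _ _
      _ ≤ 1 * ‖(1 : B)‖ := by gcongr; exact hb i
      _ = _ := one_mul _

/-- Gliding hump: only finitely many characters compose discontinuously with `D`. -/
lemma jd_finite (D : B →ₗ[ℂ] B) (hD : ∀ a b, D (a * b) = a * D b + b * D a) :
    {φ : B →ₐ[ℂ] ℂ | ¬ Continuous (fun a => φ (D a))}.Finite := by
  by_contra hinf
  let emb := Set.Infinite.natEmbedding _ hinf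
  let φ : ℕ → (B →ₐ[ℂ] ℂ) := fun n => (emb n).1
  have hφ : Function.Injective φ := fun i j h => emb.injective (Subtype.ext h)
  have hdis : ∀ n, ¬ Continuous (fun a => φ n (D a)) := fun n => (emb n).2
  obtain ⟨b₀, hb₀⟩ := jd_separate φ hφ
  obtain ⟨b, hb1, hbz, hbn⟩ : ∃ b : ℕ → B, (∀ i, ‖b i‖ ≤ 1) ∧ (∀ i, φ i (b i) = 0) ∧
      ∀ i j, i ≠ j → φ j (b i) ≠ 0 := by
    let u : ℕ → B := fun i => b₀ - φ i b₀ • 1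
    have hu : ∀ i, (0 : ℝ) < ‖u i‖ + 1 := fun i => by positivity
    refine ⟨fun i => ((‖u i‖ + 1 : ℝ) : ℂ)⁻¹ • u i, fun i => ?_, fun i => ?_, fun i j hij => ?_⟩
    · rw [norm_smul, norm_inv, Complex.norm_real, Real.norm_of_nonneg (hu i).le,
        inv_mul_le_iff₀ (hu i)]
      linarith
    · simp [u]
    · rw [map_smul, smul_eq_mul]
      refine mul_ne_zero (inv_ne_zero (by exact_mod_cast (hu i).ne')) ?_
      simp only [u, map_sub, map_smul, map_one, smul_eq_mul, mul_one]
      exact sub_ne_zero.mpr (hb₀ j i hij.symm)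
  let c : ℕ → B := fun n => ∏ i ∈ Finset.range n, b i
  have hc0 : ∀ n, φ n (c n) ≠ 0 := by
    intro n
    simp only [c, map_prod]
    refine Finset.prod_ne_zero_iff.mpr fun i hi => hbn i n ?_
    exact (Finset.mem_range.mp hi).ne
  have hdis2 : ∀ n, ¬ Continuous
      ((φ n).toLinearMap ∘ₗ D ∘ₗ LinearMap.mulLeft ℂ (c n * c n)) := by
    intro n hcont
    apply hdis n
    have h0 : φ n (c n * c n) ≠ 0 := by
      rw [map_mul]; exact mul_ne_zero (hc0 n) (hc0 n)
    have : (fun a => φ n (D a)) = fun a => (φ n (c n * c n))⁻¹ *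
        (((φ n).toLinearMap ∘ₗ D ∘ₗ LinearMap.mulLeft ℂ (c n * c n)) a
          - φ n a * φ n (D (c n * c n))) := by
      funext a
      rw [eq_inv_mul_iff_mul_eq₀ h0]
      simp only [LinearMap.comp_apply, LinearMap.mulLeft_apply, AlgHom.toLinearMap_apply]
      rw [hD (c n * c n) a, map_add, map_mul (φ n) (c n * c n), map_mul (φ n) a]
      ring
    rw [this]
    exact continuous_const.mul (hcont.sub ((jd_char_cont _).mul continuous_const))
  have hchoice : ∀ (n : ℕ) (s : B), ∃ a : B, ‖a‖ ≤ (1 / 2 : ℝ) ^ n ∧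
      (n : ℝ) + ‖φ n (D s)‖ ≤ ‖φ n (D (c n * c n * a))‖ := fun n s =>
    jd_discont _ (hdis2 n) _ _ (by positivity)
  choose g hg1 hg2 using hchoice
  let s : ℕ → B := fun n => Nat.rec 0 (fun n s => s + c n * c n * g n s) n
  have hs : ∀ n, s (n + 1) = s n + c n * c n * g n (s n) := fun n => rfl
  let a : ℕ → B := fun n => g n (s n)
  have hsum : ∀ n, s n = ∑ m ∈ Finset.range n, c m * c m * a m := by
    intro n
    induction n with
    | zero => rfl
    | succ n ih => rw [Finset.sum_range_succ, ← ih]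
  -- generic summability
  have hsummable : ∀ S : ℕ → Finset ℕ, Summable fun m =>
      (∏ i ∈ S m, b i) * (∏ i ∈ S m, b i) * a m := by
    intro S
    refine Summable.of_norm_bounded (g := fun m => ‖(1 : B)‖ * ‖(1 : B)‖ * (1 / 2 : ℝ) ^ m)
      ((summable_geometric_of_lt_one (by norm_num) (by norm_num)).mul_left _) fun m => ?_
    refine (norm_mul_le _ _).trans ?_
    gcongr
    · refine (norm_mul_le _ _).trans ?_
      gcongr <;> exact jd_prod_norm b hb1 _
    · exact hg1 m _
  have hsx := hsummable (fun m => Finset.range m)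
  set x := ∑' m, c m * c m * a m with hx
  have hbig : ∀ n : ℕ, (n : ℝ) ≤ ‖φ n (D x)‖ := by
    intro n
    have hsplit := hsx.sum_add_tsum_nat_add (n + 1)
    have htail : ∑' m, c (m + (n + 1)) * c (m + (n + 1)) * a (m + (n + 1)) =
        b n * (b n * ∑' m, (∏ i ∈ (Finset.range (m + (n + 1))).erase n, b i) *
          (∏ i ∈ (Finset.range (m + (n + 1))).erase n, b i) * a (m + (n + 1))) := by
      have hs2 := (summable_nat_add_iff (n + 1)).mpr
        (hsummable (fun m => (Finset.range m).erase n))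
      rw [← hs2.tsum_mul_left, ← (hs2.mul_left (b n)).tsum_mul_left]
      refine tsum_congr fun m => ?_
      have : c (m + (n + 1)) = b n * ∏ i ∈ (Finset.range (m + (n + 1))).erase n, b i :=
        (Finset.mul_prod_erase _ b (Finset.mem_range.mpr (by omega))).symm
      rw [this]; ring
    have hx2 : x = s n + c n * c n * a n + b n * (b n *
        ∑' m, (∏ i ∈ (Finset.range (m + (n + 1))).erase n, b i) *
          (∏ i ∈ (Finset.range (m + (n + 1))).erase n, b i) * a (m + (n + 1))) := by
      rw [← htail, ← hs n, hsum (n + 1)]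
      exact hsplit.symm
    have h3 : φ n (D x) = φ n (D (s n)) + φ n (D (c n * c n * a n)) := by
      rw [hx2, map_add, map_add, hD (b n)]
      simp [hbz n]
    have h4 := hg2 n (s n)
    have h5 : ‖φ n (D (c n * c n * a n))‖ ≤ ‖φ n (D x)‖ + ‖φ n (D (s n))‖ := by
      have : φ n (D (c n * c n * a n)) = φ n (D x) - φ n (D (s n)) := by rw [h3]; ring
      rw [this]; exact norm_sub_le _ _
    have h6 : (n : ℝ) + ‖φ n (D (s n))‖ ≤ ‖φ n (D (c n * c n * a n))‖ := h4
    linarith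
  obtain ⟨n, hn⟩ := exists_nat_gt (‖D x‖ * ‖(1 : B)‖)
  have := AlgHom.norm_apply_le_self_mul_norm_one (φ n) (D x)
  linarith [hbig n]

lemma jd_all_cont (hss : ∀ x : B, (∀ φ : B →ₐ[ℂ] ℂ, φ x = 0) → x = 0)
    (D : B →ₗ[ℂ] B) (hD : ∀ a b, D (a * b) = a * D b + b * D a) (φ : B →ₐ[ℂ] ℂ) :
    Continuous (fun a => φ (D a)) := by
  classical
  by_contra hφ
  have hfin := jd_finite D hD
  -- the common kernel of the good characters
  let K : Submodule ℂ B :=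
    ⨅ ψ : {ψ : B →ₐ[ℂ] ℂ // Continuous (fun a => ψ (D a))}, LinearMap.ker ψ.1.toLinearMap
  have hK : ∀ x, x ∈ K ↔ ∀ ψ : B →ₐ[ℂ] ℂ, Continuous (fun a => ψ (D a)) → ψ x = 0 := by
    intro x
    simp [K, Submodule.mem_iInf]
  have hKc : IsClosed (K : Set B) := by
    have : (K : Set B) = ⋂ ψ : {ψ : B →ₐ[ℂ] ℂ // Continuous (fun a => ψ (D a))},
        {x | ψ.1 x = 0} := by
      ext x
      simp [hK]
    rw [this]
    exact isClosed_iInter fun ψ => isClosed_eq (jd_char_cont _) continuous_const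
  obtain ⟨k, hkK, hk⟩ : ∃ k ∈ K, φ k ≠ 0 := by
    by_contra! hcon
    apply hφ
    haveI := hKc
    let φL : B →L[ℂ] ℂ := ⟨φ.toLinearMap, jd_char_cont φ⟩
    have hQ : Continuous (K.mkQ ∘ₗ D) := by
      refine LinearMap.continuous_of_seq_closed_graph _ fun u x y hu hy => ?_
      obtain ⟨z, rfl⟩ := K.mkQ_surjective y
      rw [LinearMap.comp_apply, ← sub_eq_zero, ← map_sub]
      rw [Submodule.mkQ_apply, Submodule.Quotient.mk_eq_zero, hK]
      intro ψ hψ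
      let ψL : B →L[ℂ] ℂ := ⟨ψ.toLinearMap, jd_char_cont ψ⟩
      have hle : K ≤ LinearMap.ker ψL.toLinearMap := fun v hv => (hK v).mp hv ψ hψ
      have h1 := ((K.liftQL ψL hle).continuous.tendsto _).comp hy
      have h2 := (hψ.tendsto x).comp hu
      have h3 := tendsto_nhds_unique h1 h2
      rw [map_sub, sub_eq_zero]
      exact h3
    have hle : K ≤ LinearMap.ker φL.toLinearMap := fun v hv => hcon v hv
    exact (K.liftQL φL hle).continuous.comp hQ
  -- separate from other bad characters
  obtain ⟨q, hq, hq0⟩ : ∃ q : B, φ q ≠ 0 ∧ ∀ ψ : B →ₐ[ℂ] ℂ, ψ ≠ φ → ψ q = 0 := by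
    have hsep : ∀ ψ : B →ₐ[ℂ] ℂ, ∃ v : B, ψ ≠ φ → (ψ v = 0 ∧ φ v ≠ 0) := by
      intro ψ
      by_cases h : ψ = φ
      · exact ⟨0, fun h' => absurd h h'⟩
      · obtain ⟨v, hv⟩ : ∃ v, ψ v ≠ φ v := by
          by_contra! h'
          exact h (AlgHom.ext h')
        refine ⟨v - ψ v • 1, fun _ => ⟨by simp, ?_⟩⟩
        simpa [sub_eq_zero] using hv.symm
    choose v hv using hsep
    refine ⟨k * ∏ ψ ∈ hfin.toFinset.erase φ, v ψ, ?_, ?_⟩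
    · rw [map_mul, map_prod]
      refine mul_ne_zero hk (Finset.prod_ne_zero_iff.mpr fun ψ hψ => ?_)
      exact (hv ψ (Finset.ne_of_mem_erase hψ)).2
    · intro ψ hne
      rw [map_mul, map_prod]
      by_cases hψ : Continuous (fun a => ψ (D a))
      · rw [(hK k).mp hkK ψ hψ, zero_mul]
      · rw [Finset.prod_eq_zero (i := ψ) (by simp [hne, hψ]) (hv ψ hne).1, mul_zero]
  let p : B := (φ q)⁻¹ • q
  have hp1 : φ p = 1 := by simp [p, hq]
  have hp0 : ∀ ψ : B →ₐ[ℂ] ℂ, ψ ≠ φ → ψ p = 0 := fun ψ h => by simp [p, hq0 ψ h]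
  have hmul : ∀ a : B, p * a = φ a • p := by
    intro a
    rw [← sub_eq_zero]
    refine hss _ fun ψ => ?_
    by_cases h : ψ = φ
    · subst h; simp [hp1]
    · simp [hp0 ψ h]
  have hpp : p * p = p := by rw [hmul, hp1, one_smul]
  have hDp : φ (D p) = 0 := by
    have := congrArg φ (hD p p)
    rw [hpp] at this
    simp only [map_add, map_mul, hp1, one_mul] at this
    linear_combination -this
  apply hφ
  have : (fun a => φ (D a)) = fun _ => 0 := by
    funext a
    have := congrArg φ (hD p a)
    rw [hmul] at this
    simp only [map_add, map_mul, map_smul, hp1, hDp, one_mul, smul_eq_mul, mul_zero,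
      add_zero] at this
    exact this.symm
  rw [this]
  exact continuous_const

/-- Johnson: derivations of commutative semisimple Banach algebras vanish. -/
theorem jd_johnson (hss : ∀ x : B, (∀ φ : B →ₐ[ℂ] ℂ, φ x = 0) → x = 0)
    (D : B →ₗ[ℂ] B) (hD : ∀ a b, D (a * b) = a * D b + b * D a) (a : B) : D a = 0 := by
  have hc : Continuous D := by
    refine LinearMap.continuous_of_seq_closed_graph _ fun u x y hu hy => ?_
    rw [← sub_eq_zero]
    refine hss _ fun φ => ?_
    have h1 := ((jd_char_cont φ).tendsto y).comp hy
    have h2 := ((jd_all_cont hss D hD φ).tendsto x).comp hu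
    rw [map_sub, sub_eq_zero]
    exact tendsto_nhds_unique h1 h2
  exact hss _ fun φ => jd_singer_wermer D hD hc φ a

theorem jd_johnson' (hss : (⊥ : Ideal B).jacobson = ⊥)
    (D : B →ₗ[ℂ] B) (hD : ∀ a b, D (a * b) = a * D b + b * D a) (a : B) : D a = 0 := by
  refine jd_johnson (fun x hx => ?_) D hD a
  have : x ∈ (⊥ : Ideal B).jacobson := by
    rw [Ideal.jacobson, Submodule.mem_sInf]
    rintro (J : Ideal B) ⟨-, hJ⟩
    haveI : J.IsMaximal := hJ
    by_contra hxJ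
    have hmem : ∀ z ∈ J, WeakDual.CharacterSpace.equivAlgHom (Ideal.toCharacterSpace J) z = 0 :=
      fun z hz => Ideal.toCharacterSpace_apply_eq_zero_of_mem J hz
    obtain ⟨y, i, hi, h⟩ := hJ.exists_inv hxJ
    have h1 := congrArg (WeakDual.CharacterSpace.equivAlgHom (Ideal.toCharacterSpace J)) h
    rw [map_add, map_mul, hx, hmem i hi, map_one] at h1
    simp at h1
  rw [hss] at this
  simpa using this

end JohnsonCore

/-- Let `A` be a complex Banach algebra with a right identity `e` such that
the subalgebra `eA` is commutative and semisimple (its Jacobson radical is zero).  Then every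
Jordan derivation `d` of `A` maps `A` into the right annihilator
`ran(A) = {x | ∀ a, a * x = 0}`. -/
theorem jordanDerivation_range_subset_rightAnnihilator
    {A : Type*} [NonUnitalNormedRing A] [NormedSpace ℂ A]
    [IsScalarTower ℂ A A] [SMulCommClass ℂ A A] [CompleteSpace A]
    (e : A) (he : ∀ a : A, a * e = a)
    (hcomm : ∀ a b : A, (e * a) * (e * b) = (e * b) * (e * a))
    (hss : letI : Ring (eSub e) := eRing e he
           (⊥ : Ideal (eSub e)).jacobson = ⊥)
    (d : A →ₗ[ℂ] A) (hd : ∀ a : A, d (a * a) = d a * a + a * d a) :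
    ∀ a x : A, x * d a = 0 := by
  letI instN : NormedCommRing (eSub e) :=
    { (inferInstance : NonUnitalNormedRing (eSub e)) with
      one := ⟨e, e, he e⟩
      one_mul := (eRing e he).one_mul
      mul_one := (eRing e he).mul_one
      mul_comm := by
        rintro ⟨x, a, rfl⟩ ⟨y, b, rfl⟩
        exact Subtype.ext (hcomm a b) }
  letI instA : Algebra ℂ (eSub e) := Algebra.ofModule
    (fun r x y => smul_mul_assoc r x y) (fun r x y => mul_smul_comm r x y)
  letI instNA : NormedAlgebra ℂ (eSub e) :=
    { instA with norm_smul_le := fun r x => (norm_smul_le r (x : A)) }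
  have hmemiff : ∀ x : A, x ∈ eSub e ↔ e * x = x := by
    intro x
    constructor
    · rintro ⟨a, rfl⟩
      show e * (e * a) = e * a
      rw [← mul_assoc, he]
    · intro h; exact ⟨x, h⟩
  haveI : CompleteSpace (eSub e) := by
    have hcl : IsClosed ((eSub e : Set A)) := by
      have : (eSub e : Set A) = {x | e * x = x} := by
        ext x; exact hmemiff x
      rw [this]
      exact isClosed_eq (continuous_const.mul continuous_id) continuous_id
    exact hcl.completeSpace_coe
  -- polarised Jordan identity
  have hpol : ∀ a b : A, d (a * b) + d (b * a) = d a * b + d b * a + a * d b + b * d a := by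
    intro a b
    have h := hd (a + b)
    simp only [add_mul, mul_add, map_add, hd] at h
    have h' := sub_eq_zero.mpr h
    rw [← sub_eq_zero, ← h']
    abel
  have hπ : ∀ a b : A, (e * a) * (e * b) = e * (a * b) := by
    intro a b
    rw [← mul_assoc (e * a), he, mul_assoc]
  have hπc : ∀ a b : A, e * (a * b) = e * (b * a) := by
    intro a b
    rw [← hπ, hcomm, hπ]
  have hπ2 : ∀ a b : A, e * (a * b) + e * (b * a) = (2 : ℂ) • (e * (a * b)) := by
    intro a b
    rw [hπc b a, two_smul]
  let δ : eSub e →ₗ[ℂ] eSub e :=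
    { toFun := fun x => ⟨e * d x, d x, rfl⟩
      map_add' := fun x y => Subtype.ext (by
        show e * d ((x : A) + y) = e * d x + e * d y
        rw [map_add, mul_add])
      map_smul' := fun r x => Subtype.ext (by
        show e * d (r • (x : A)) = r • (e * d x)
        rw [map_smul, mul_smul_comm]) }
  have hδ : ∀ x y : eSub e, δ (x * y) = x * δ y + y * δ x := by
    intro x y
    apply Subtype.ext
    show e * d ((x : A) * y) = x * (e * d y) + y * (e * d x)
    have hx := (hmemiff x).mp x.2
    have hy := (hmemiff y).mp y.2
    have hxy : (y : A) * x = x * y := by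
      have := hcomm (y : A) x
      rwa [hx, hy] at this
    have h := congrArg (e * ·) (hpol (x : A) y)
    simp only [hxy, mul_add] at h
    rw [hπc (d x) y, hπc (d y) x] at h
    have e1 : (x : A) * (e * d y) = e * (x * d y) := by
      rw [← hπ, hx]
    have e2 : (y : A) * (e * d x) = e * (y * d x) := by
      rw [← hπ, hy]
    rw [e1, e2]
    have h2 : (2 : ℂ) • (e * d ((x : A) * y)) =
        (2 : ℂ) • (e * ((x : A) * d y) + e * ((y : A) * d x)) := by
      rw [two_smul, two_smul, h]; abel
    exact smul_right_injective A (two_ne_zero : (2 : ℂ) ≠ 0) h2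
  have hzero : ∀ x : eSub e, δ x = 0 := jd_johnson' hss δ hδ
  have hz1 : ∀ a : A, e * d (e * a) = 0 := fun a =>
    congrArg Subtype.val (hzero ⟨e * a, a, rfl⟩)
  have hde : e * d e = 0 := by
    have := hz1 e
    rwa [he] at this
  have hz2 : ∀ a : A, e * d a = 0 := by
    intro a
    have h := congrArg (e * ·) (hpol e a)
    simp only [mul_add, he, hz1, zero_add] at h
    -- h : e * d a = e * (d e * a) + e * d a + e * (e * d a) + e * (a * d e)
    have e1 : e * (d e * a) = 0 := by rw [← mul_assoc, hde, zero_mul]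
    have e2 : e * (a * d e) = 0 := by rw [hπc, e1]
    have e3 : e * (e * d a) = e * d a := by rw [← mul_assoc, he]
    rw [e1, e2, e3] at h
    simpa using h
  intro a x
  rw [← he x, mul_assoc, hz2, mul_zero]
end

section
/- Let A be a Banach algebra with a right identity e such that the subalgebra eA = {e·a : a ∈ A} is commutative and semisimple (its Jacobson radical is zero). Then the range of every Jordan derivation of A is contained in the Jacobson radical rad(A) of A. -/
open WeakDual in
theorem aux_char_bound {B : Type*} [NormedCommRing B] [NormedAlgebra ℂ B] [CompleteSpace B]
    (φ : characterSpace ℂ B) (a : B) : ‖φ a‖ ≤ ‖a‖ * ‖(1 : B)‖ :=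
  spectrum.norm_le_norm_mul_of_mem (CharacterSpace.apply_mem_spectrum φ a)

theorem aux_D_one {B : Type*} [CommRing B] (D : B → B)
    (hD : ∀ a b, D (a * b) = a * D b + D a * b) : D 1 = 0 := by
  have := hD 1 1
  simp only [mul_one, one_mul] at this
  exact left_eq_add.mp this

open WeakDual in
theorem aux_iter {B : Type*} [NormedCommRing B] [NormedAlgebra ℂ B] [CompleteSpace B]
    (D : B →ₗ[ℂ] B) (hD : ∀ a b, D (a * b) = a * D b + D a * b)
    (φ : characterSpace ℂ B) (a : B) (ha : φ a = 0) (n : ℕ) :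
    ∀ b, φ (D^[n] (a ^ n * b)) = n.factorial * φ (D a) ^ n * φ b := by
  induction n with
  | zero => intro b; simp
  | succ n ih =>
    intro b
    have hp : ∀ k : ℕ, D (a ^ (k + 1)) = ((k : B) + 1) * (a ^ k * D a) := by
      intro k
      induction k with
      | zero => simp
      | succ k ihk => rw [pow_succ, hD, ihk]; push_cast; ring
    have h1 : D (a ^ (n + 1) * b) = a ^ n * (((n : B) + 1) * (D a * b) + a * D b) := by
      rw [hD, hp]; ring
    rw [Function.iterate_succ_apply, h1, ih]
    simp only [map_add, map_mul, map_natCast, map_one, ha, zero_mul, add_zero]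
    rw [Nat.factorial_succ]; push_cast; ring

open WeakDual in
/-- Singer–Wermer for bounded derivations. -/
theorem aux_SW {B : Type*} [NormedCommRing B] [NormedAlgebra ℂ B] [CompleteSpace B]
    (D : B →ₗ[ℂ] B) (hD : ∀ a b, D (a * b) = a * D b + D a * b) (hc : Continuous D)
    (φ : characterSpace ℂ B) (a : B) : φ (D a) = 0 := by
  have key : ∀ a, φ a = 0 → φ (D a) = 0 := by
    intro a ha
    by_contra hne
    have ht : 0 < ‖φ (D a)‖ := norm_pos_iff.mpr hne
    set T : B →L[ℂ] B := ⟨D, hc⟩ with hT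
    have hit : ∀ n x, ‖D^[n] x‖ ≤ ‖T‖ ^ n * ‖x‖ := by
      intro n
      induction n with
      | zero => intro x; simp
      | succ n ih =>
        intro x
        rw [Function.iterate_succ_apply]
        calc _ ≤ ‖T‖ ^ n * ‖D x‖ := ih _
          _ ≤ ‖T‖ ^ n * (‖T‖ * ‖x‖) := by gcongr; exact T.le_opNorm x
          _ = _ := by ring
    have hpw : ∀ n, ‖a ^ n‖ ≤ ‖a‖ ^ n * ‖(1 : B)‖ := by
      intro n
      induction n with
      | zero => simp
      | succ n ih =>
        rw [pow_succ]
        calc _ ≤ ‖a ^ n‖ * ‖a‖ := norm_mul_le _ _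
          _ ≤ ‖a‖ ^ n * ‖(1 : B)‖ * ‖a‖ := by gcongr
          _ = _ := by ring
    have hb : ∀ n : ℕ, (n.factorial : ℝ) * ‖φ (D a)‖ ^ n
        ≤ (‖T‖ * ‖a‖) ^ n * (‖(1 : B)‖ * ‖(1 : B)‖) := by
      intro n
      have h := aux_iter D hD φ a ha n 1
      rw [map_one, mul_one, mul_one] at h
      have h2 := aux_char_bound φ (D^[n] (a ^ n))
      rw [h, norm_mul, norm_pow, Complex.norm_natCast] at h2
      calc _ ≤ _ := h2
        _ ≤ (‖T‖ ^ n * (‖a‖ ^ n * ‖(1 : B)‖)) * ‖(1 : B)‖ := by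
          gcongr
          exact (hit n _).trans (by gcongr; exact hpw n)
        _ = _ := by rw [mul_pow]; ring
    have hl := (FloorSemiring.tendsto_pow_div_factorial_atTop (K := ℝ)
      (‖T‖ * ‖a‖ / ‖φ (D a)‖)).mul_const (‖(1 : B)‖ * ‖(1 : B)‖)
    rw [zero_mul] at hl
    obtain ⟨n, hn⟩ := (hl.eventually (gt_mem_nhds one_pos)).exists
    have hf : (0 : ℝ) < n.factorial := by exact_mod_cast n.factorial_pos
    have := hb n
    rw [div_pow, div_div, div_mul_eq_mul_div, div_lt_one (by positivity)] at hn
    linarith [mul_comm (n.factorial : ℝ) (‖φ (D a)‖ ^ n)]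
  have h := key (a - algebraMap ℂ B (φ a)) (by
    rw [map_sub, AlgHomClass.commutes]; simp)
  rwa [map_sub, Algebra.algebraMap_eq_smul_one, map_smul, aux_D_one D hD, smul_zero, sub_zero] at h

open WeakDual in
def auxF {B : Type*} [NormedCommRing B] [NormedAlgebra ℂ B] 
    (D : B →ₗ[ℂ] B) : Set (characterSpace ℂ B) :=
  {φ | ∀ C : ℝ, ∃ x : B, ‖x‖ ≤ 1 ∧ C ≤ ‖φ (D x)‖}

open WeakDual in
theorem aux_sep {B : Type*} [NormedCommRing B] [NormedAlgebra ℂ B] 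
    (φ ψ : characterSpace ℂ B) (h : φ ≠ ψ) : ∃ b, φ b = 0 ∧ ψ b = 1 := by
  obtain ⟨x, hx⟩ := DFunLike.ne_iff.mp h
  have hx' : ψ x - φ x ≠ 0 := sub_ne_zero.mpr hx.symm
  refine ⟨(ψ x - φ x)⁻¹ • (x - algebraMap ℂ B (φ x)), ?_, ?_⟩
  · rw [map_smul, map_sub, AlgHomClass.commutes]; simp
  · rw [map_smul, map_sub, AlgHomClass.commutes]; simp [hx']

open WeakDual in
/-- choice of characters and elements -/
theorem aux_seq {B : Type*} [NormedCommRing B] [NormedAlgebra ℂ B] 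
    (F : Set (characterSpace ℂ B)) (hF : F.Infinite) :
    ∃ (φ : ℕ → characterSpace ℂ B) (b : ℕ → B), (∀ n, φ n ∈ F) ∧ (∀ n, ‖b n‖ ≤ 1) ∧
      (∀ n, φ n (b n) = 0) ∧ ∀ m n, m < n → φ n (b m) ≠ 0 := by
  have step : ∀ G : {G : Set (characterSpace ℂ B) // G.Infinite},
      ∃ (p : characterSpace ℂ B × B) (G' : {G : Set (characterSpace ℂ B) // G.Infinite}),
        p.1 ∈ G.1 ∧ ‖p.2‖ ≤ 1 ∧ p.1 p.2 = 0 ∧ G'.1 ⊆ G.1 ∧ ∀ ψ ∈ G'.1, ψ p.2 ≠ 0 := by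
    rintro ⟨G, hG⟩
    have main : ∃ (φ : characterSpace ℂ B) (b : B), φ ∈ G ∧ φ b = 0 ∧
        {ψ ∈ G | ψ b ≠ 0}.Infinite := by
      obtain ⟨φ, hφ, ψ, hψ, hne⟩ := hG.nontrivial
      obtain ⟨b, hb0, hb1⟩ := aux_sep φ ψ hne
      have hU : {χ ∈ G | χ b ≠ 0} ∪ {χ ∈ G | χ (1 - b) ≠ 0} = G := by
        ext χ
        simp only [Set.mem_union, Set.mem_ofPred_eq, map_sub, map_one]
        constructor
        · rintro (h | h) <;> exact h.1
        · intro h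
          by_cases h0 : χ b = 0
          · right; exact ⟨h, by simp [h0]⟩
          · left; exact ⟨h, h0⟩
      rw [← hU, Set.infinite_union] at hG
      rcases hG with h | h
      · exact ⟨φ, b, hφ, hb0, h⟩
      · exact ⟨ψ, 1 - b, hψ, by simp [hb1], h⟩
    obtain ⟨φ, b, hφ, hb, hinf⟩ := main
    have hpos : (0 : ℝ) < 1 + ‖b‖ := by positivity
    have hc : ((1 + ‖b‖ : ℝ) : ℂ)⁻¹ ≠ 0 := inv_ne_zero (by exact_mod_cast hpos.ne')
    refine ⟨⟨φ, ((1 + ‖b‖ : ℝ) : ℂ)⁻¹ • b⟩, ⟨_, hinf⟩, hφ, ?_, ?_, fun x hx => hx.1, ?_⟩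
    · rw [norm_smul, norm_inv, Complex.norm_real, Real.norm_of_nonneg hpos.le,
        inv_mul_le_iff₀ hpos]
      linarith
    · show φ (_ • b) = 0
      rw [map_smul, hb, smul_zero]
    · intro ψ hψ
      show ψ (_ • b) ≠ 0
      rw [map_smul]
      exact smul_ne_zero hc hψ.2
  choose p G' h1 h2 h3 h4 h5 using step
  let G : ℕ → {G : Set (characterSpace ℂ B) // G.Infinite} := fun n =>
    Nat.rec ⟨F, hF⟩ (fun _ g => G' g) n
  have hGs : ∀ n, G (n + 1) = G' (G n) := fun n => rfl
  have hanti : Antitone (fun n => (G n).1) := antitone_nat_of_succ_le (fun n => by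
    show (G (n + 1)).1 ⊆ (G n).1
    rw [hGs]; exact h4 _)
  refine ⟨fun n => (p (G n)).1, fun n => (p (G n)).2, fun n => hanti (Nat.zero_le n) (h1 _),
    fun n => h2 _, fun n => h3 _, fun m n hmn => ?_⟩
  apply h5 (G m)
  rw [← hGs]
  exact hanti hmn (h1 _)

open WeakDual in
theorem aux_unbdd {B : Type*} [NormedCommRing B] [NormedAlgebra ℂ B] [CompleteSpace B]
    (D : B →ₗ[ℂ] B) (hD : ∀ a b, D (a * b) = a * D b + D a * b)
    (φ : characterSpace ℂ B) (hφ : φ ∈ auxF D) (c : B) (hc : φ c ≠ 0) (ε : ℝ) (hε : 0 < ε)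
    (C : ℝ) : ∃ x : B, ‖x‖ ≤ ε ∧ C ≤ ‖φ (D (c * x))‖ := by
  have hc' : 0 < ‖φ c‖ := norm_pos_iff.mpr hc
  obtain ⟨x, hx1, hx2⟩ := hφ ((C / ε + ‖φ (D c)‖ * ‖(1 : B)‖) / ‖φ c‖)
  refine ⟨(ε : ℂ) • x, ?_, ?_⟩
  · rw [norm_smul, Complex.norm_real, Real.norm_of_nonneg hε.le]
    nlinarith
  · rw [mul_smul_comm, map_smul, map_smul, norm_smul, Complex.norm_real,
      Real.norm_of_nonneg hε.le, hD, map_add, map_mul, map_mul]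
    rw [div_le_iff₀ hc'] at hx2
    have h3 : ‖φ x‖ ≤ ‖(1 : B)‖ := (aux_char_bound φ x).trans (by
      nlinarith [norm_nonneg (1 : B)])
    have h4 : ‖φ c * φ (D x)‖ - ‖φ (D c) * φ x‖ ≤ ‖φ c * φ (D x) + φ (D c) * φ x‖ := by
      have := norm_sub_norm_le (φ c * φ (D x)) (-(φ (D c) * φ x))
      rwa [norm_neg, sub_neg_eq_add] at this
    rw [norm_mul, norm_mul] at h4
    have h5 : ‖φ (D c)‖ * ‖φ x‖ ≤ ‖φ (D c)‖ * ‖(1 : B)‖ := by gcongr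
    have h6 : C / ε ≤ ‖φ c * φ (D x) + φ (D c) * φ x‖ := by linarith
    rwa [div_le_iff₀' hε] at h6

open WeakDual in
theorem aux_finite {B : Type*} [NormedCommRing B] [NormedAlgebra ℂ B] [CompleteSpace B]
    (D : B →ₗ[ℂ] B) (hD : ∀ a b, D (a * b) = a * D b + D a * b) : (auxF D).Finite := by
  by_contra hinf
  obtain ⟨φ, b, hφ, hb, h0, hne⟩ := aux_seq (auxF D) hinf
  let c : ℕ → B := fun n => ∏ i ∈ Finset.range n, b i
  have hcs : ∀ n, c (n + 1) = c n * b n := fun n => Finset.prod_range_succ _ _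
  have hc0 : ∀ n, φ n (c (n + 1)) = 0 := fun n => by rw [hcs, map_mul, h0, mul_zero]
  have hc1 : ∀ n, φ n (c n) ≠ 0 := fun n => by
    simp only [c, map_prod]
    exact Finset.prod_ne_zero_iff.mpr fun i hi => hne i n (Finset.mem_range.mp hi)
  have ex : ∀ (n : ℕ) (s : B), ∃ x : B, ‖x‖ ≤ (1 / 2 : ℝ) ^ n ∧
      n + ‖φ n (D s)‖ + ‖φ n (D (c (n + 1)))‖ * (2 * ‖(1 : B)‖) ≤ ‖φ n (D (c n * x))‖ :=
    fun n s => aux_unbdd D hD (φ n) (hφ n) (c n) (hc1 n) _ (by positivity) _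
  choose g hg1 hg2 using ex
  let s : ℕ → B := fun n => Nat.rec 0 (fun k t => t + c k * g k t) n
  let x : ℕ → B := fun n => g n (s n)
  have hss : ∀ n, s (n + 1) = s n + c n * x n := fun n => rfl
  have hx : ∀ n, ‖x n‖ ≤ (1 / 2 : ℝ) ^ n := fun n => hg1 _ _
  have hprod : ∀ (m n : ℕ) (z : B), ‖(∏ i ∈ Finset.range n, b (m + i)) * z‖ ≤ ‖z‖ := by
    intro m n
    induction n with
    | zero => intro z; simp
    | succ n ih =>
      intro z
      rw [Finset.prod_range_succ, mul_assoc]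
      refine (ih _).trans ((norm_mul_le _ _).trans ?_)
      have := hb (m + n)
      nlinarith [norm_nonneg z]
  let f : ℕ → ℕ → B := fun m n => (∏ i ∈ Finset.range n, b (m + i)) * x (m + n)
  have hfb : ∀ m n, ‖f m n‖ ≤ (1 / 2 : ℝ) ^ n := fun m n =>
    (hprod m n _).trans ((hx _).trans (pow_le_pow_of_le_one (by norm_num) (by norm_num) (by lia)))
  have hsum : ∀ m, Summable (f m) := fun m =>
    Summable.of_norm_bounded summable_geometric_two (hfb m)
  let y : ℕ → B := fun m => ∑' n, f m n
  have hy : ∀ m, ‖y m‖ ≤ 2 := fun m => by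
    have := tsum_of_norm_bounded (hasSum_geometric_two) (hfb m)
    exact this
  have hrec : ∀ m, y m = x m + b m * y (m + 1) := by
    intro m
    show ∑' n, f m n = _
    rw [(hsum m).tsum_eq_zero_add]
    congr 1
    · simp [f]
    · rw [← (hsum (m + 1)).tsum_mul_left]
      refine tsum_congr fun n => ?_
      simp only [f]
      rw [Finset.prod_range_succ', add_zero, ← mul_assoc, mul_comm (b m)]
      have e1 : ∀ i, m + (i + 1) = m + 1 + i := fun i => by lia
      rw [e1 n, Finset.prod_congr rfl fun i _ => congrArg b (e1 i)]
  have hdec : ∀ m, y 0 = s m + c m * y m := by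
    intro m
    induction m with
    | zero => simp [s, c]
    | succ m ih => rw [ih, hss, hcs, hrec m]; ring
  have hbound : ∀ m : ℕ, (m : ℝ) ≤ ‖D (y 0)‖ * ‖(1 : B)‖ := by
    intro m
    refine le_trans ?_ (aux_char_bound (φ m) (D (y 0)))
    have h := hg2 m (s m)
    change _ ≤ ‖φ m (D (c m * x m))‖ at h
    have e : φ m (D (y 0)) = φ m (D (c m * x m)) + (φ m (D (s m)) +
        φ m (D (c (m + 1))) * φ m (y (m + 1))) := by
      rw [hdec (m + 1), hss, map_add, map_add, hD (c (m + 1)), map_add, map_add, map_add,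
        map_mul (φ m) (c (m + 1)), map_mul (φ m) (D (c (m + 1))), hc0]
      ring
    rw [e]
    have h1 := norm_sub_norm_le (φ m (D (c m * x m))) (-(φ m (D (s m)) +
        φ m (D (c (m + 1))) * φ m (y (m + 1))))
    rw [norm_neg, sub_neg_eq_add] at h1
    have h2 := norm_add_le (φ m (D (s m))) (φ m (D (c (m + 1))) * φ m (y (m + 1)))
    rw [norm_mul] at h2
    have h3 : ‖φ m (y (m + 1))‖ ≤ 2 * ‖(1 : B)‖ := (aux_char_bound _ _).trans (by
      gcongr; exact hy _)
    have h4 : ‖φ m (D (c (m + 1)))‖ * ‖φ m (y (m + 1))‖ ≤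
      ‖φ m (D (c (m + 1)))‖ * (2 * ‖(1 : B)‖) := by gcongr
    linarith
  obtain ⟨m, hm⟩ := exists_nat_gt (‖D (y 0)‖ * ‖(1 : B)‖)
  exact absurd (hbound m) (not_le.mpr hm)

open WeakDual in
theorem aux_continuous {B : Type*} [NormedCommRing B] [NormedAlgebra ℂ B] [CompleteSpace B]
    (hss : ∀ a : B, (∀ φ : characterSpace ℂ B, φ a = 0) → a = 0)
    (D : B →ₗ[ℂ] B) (hD : ∀ a b, D (a * b) = a * D b + D a * b) : Continuous D := by
  classical
  have hfin := aux_finite D hD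
  have notF : ∀ φ : characterSpace ℂ B, φ ∉ auxF D → ∀ v : ℕ → B,
      Filter.Tendsto v Filter.atTop (nhds 0) →
      Filter.Tendsto (fun n => φ (D (v n))) Filter.atTop (nhds 0) := by
    intro φ hφ v hv
    simp only [auxF, Set.mem_ofPred_eq, not_forall, not_exists, not_and, not_le] at hφ
    obtain ⟨C, hC⟩ := hφ
    let L : B →ₗ[ℂ] ℂ := (φ : characterSpace ℂ B).1.toLinearMap.comp D
    have hL : ∀ x, L x = φ (D x) := fun x => rfl
    have hcont : Continuous L := by
      refine (LinearMap.mkContinuousOfExistsBound L ?_).continuous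
      refine ⟨C, fun z => ?_⟩
      refine LinearMap.bound_of_ball_bound' (r := 1) one_pos C L ?_ z |>.trans_eq (by simp)
      intro z hz
      exact (hC z (by simpa using hz)).le
    have := (hcont.tendsto 0).comp hv
    rw [map_zero] at this
    exact this
  refine D.continuous_of_seq_closed_graph ?_
  intro u x y hu hDu
  rw [← sub_eq_zero]
  have hv : Filter.Tendsto (fun n => u n - x) Filter.atTop (nhds 0) := by
    simpa using hu.sub_const x
  have hDv : Filter.Tendsto (fun n => D (u n - x)) Filter.atTop (nhds (y - D x)) := by
    simpa using hDu.sub_const (D x)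
  have hφv : ∀ φ : characterSpace ℂ B,
      Filter.Tendsto (fun n => φ (D (u n - x))) Filter.atTop (nhds (φ (y - D x))) := fun φ =>
    ((map_continuous φ).tendsto _).comp hDv
  have hout : ∀ φ : characterSpace ℂ B, φ ∉ auxF D → φ (y - D x) = 0 := fun φ hφ =>
    tendsto_nhds_unique (hφv φ) (notF φ hφ _ hv)
  apply hss
  intro φ
  by_contra hne
  have hφF : φ ∈ auxF D := by
    by_contra h; exact hne (hout φ h)
  have hsep : ∀ ψ : characterSpace ℂ B, ∃ b : B, φ b = 1 ∧ (ψ ≠ φ → ψ b = 0) := by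
    intro ψ
    by_cases h : ψ = φ
    · exact ⟨1, map_one _, fun h' => absurd h h'⟩
    · obtain ⟨b, hb, hb'⟩ := aux_sep ψ φ h
      exact ⟨b, hb', fun _ => hb⟩
  choose β hβ1 hβ0 using hsep
  set σ := y - D x with hσ
  let c : B := ∏ ψ ∈ hfin.toFinset, β ψ
  let p : B := (φ σ)⁻¹ • (c * σ)
  have hp1 : φ p = 1 := by
    simp only [p, c, map_smul, map_mul, map_prod, hβ1, Finset.prod_const_one, one_mul, smul_eq_mul]
    exact inv_mul_cancel₀ hne
  have hp0 : ∀ ψ : characterSpace ℂ B, ψ ≠ φ → ψ p = 0 := by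
    intro ψ hψ
    simp only [p, c, map_smul, map_mul, map_prod]
    by_cases h : ψ ∈ auxF D
    · rw [Finset.prod_eq_zero (hfin.mem_toFinset.mpr h) (hβ0 ψ hψ)]; simp
    · rw [hout ψ h]; simp
  have hpa : ∀ a, p * a = φ a • p := by
    intro a
    rw [← sub_eq_zero]
    apply hss
    intro ψ
    rw [map_sub, map_mul, map_smul ψ (φ a) p, smul_eq_mul]
    by_cases h : ψ = φ
    · rw [h, hp1]; ring
    · rw [hp0 ψ h]; ring
  have hpp : p * p = p := by rw [hpa, hp1, one_smul]
  have hDp : D p = 0 := by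
    have h1 := hD p p
    rw [hpp] at h1
    have h2 : p * D p = 0 := by
      have h3 : p * D p = p * (p * D p + D p * p) := congrArg (p * ·) h1
      have h4 : p * (p * D p + D p * p) = (p * p) * D p + (p * p) * D p := by ring
      rw [h4, hpp] at h3
      exact left_eq_add.mp h3
    rw [mul_comm (D p), h2, add_zero] at h1
    exact h1
  have hz : ∀ a, φ (D a) = 0 := by
    intro a
    have h1 := congrArg φ (hD p a)
    rw [hpa, map_smul, hDp, smul_zero, zero_mul, add_zero, map_zero, map_mul, hp1, one_mul] at h1
    exact h1.symm
  obtain ⟨z, -, hz1⟩ := hφF 1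
  rw [hz, norm_zero] at hz1
  linarith

open WeakDual in
theorem aux_main {B : Type*} [NormedCommRing B] [NormedAlgebra ℂ B] [CompleteSpace B]
    (hss : (⊥ : Ideal B).jacobson = ⊥)
    (D : B →ₗ[ℂ] B) (hD : ∀ a b, D (a * b) = a * D b + D a * b) (a : B) : D a = 0 := by
  have hss' : ∀ a : B, (∀ φ : characterSpace ℂ B, φ a = 0) → a = 0 := by
    intro a ha
    have : a ∈ (⊥ : Ideal B).jacobson := by
      rw [Ideal.mem_jacobson_iff]
      intro y
      have hu : IsUnit (y * a + 1) := by
        by_contra h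
        obtain ⟨φ, hφ⟩ := CharacterSpace.exists_apply_eq_zero h
        rw [map_add, map_mul, ha, map_one] at hφ
        simp at hφ
      obtain ⟨z, hz⟩ := hu.exists_left_inv
      refine ⟨z, ?_⟩
      rw [Ideal.mem_bot, ← hz]
      ring
    rw [hss] at this
    exact this
  exact hss' _ fun φ => aux_SW D hD (aux_continuous hss' D hD) φ a

abbrev auxNormed {A : Type*} [NonUnitalNormedRing A] [NormedSpace ℂ A]
    [IsScalarTower ℂ A A] [SMulCommClass ℂ A A] (e : A) (he : ∀ a : A, a * e = a)
    (hcomm : ∀ a b : A, (e * a) * (e * b) = (e * b) * (e * a)) : NormedCommRing (eSub e) :=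
  { (inferInstance : NonUnitalNormedRing (eSub e)) with
    one := ⟨e, e, he e⟩
    one_mul := (eRing e he).one_mul
    mul_one := (eRing e he).mul_one
    mul_comm := by
      rintro ⟨x, a, rfl⟩ ⟨y, b, rfl⟩
      exact Subtype.ext (hcomm a b) }

/-- Let `A` be a complex Banach algebra with a right identity `e` such that
the subalgebra `eA` is commutative and semisimple (its Jacobson radical is zero).  Then the
range of every Jordan derivation of `A` is contained in the Jacobson radical of `A`
(an element of the non-unital algebra `A` lies in its Jacobson radical iff its image in the
unitization lies in the Jacobson radical of the unitization). -/
theorem jordanDerivation_range_subset_radical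
    {A : Type*} [NonUnitalNormedRing A] [NormedSpace ℂ A]
    [IsScalarTower ℂ A A] [SMulCommClass ℂ A A] [CompleteSpace A]
    (e : A) (he : ∀ a : A, a * e = a)
    (hcomm : ∀ a b : A, (e * a) * (e * b) = (e * b) * (e * a))
    (hss : letI : Ring (eSub e) := eRing e he
           (⊥ : Ideal (eSub e)).jacobson = ⊥)
    (d : A →ₗ[ℂ] A) (hd : ∀ a : A, d (a * a) = d a * a + a * d a) :
    ∀ a : A, ((d a : A) : Unitization ℂ A) ∈ (⊥ : Ideal (Unitization ℂ A)).jacobson := by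
  have hJ : ∀ a b, d (a * b) + d (b * a) = d a * b + a * d b + d b * a + b * d a := by
    intro a b
    have h := hd (a + b)
    simp only [mul_add, add_mul, map_add, hd] at h
    have h' : d (a * b) + d (b * a) - (d a * b + a * d b + d b * a + b * d a) = 0 := by
      rw [← sub_eq_zero] at h
      rw [← h]; abel
    exact sub_eq_zero.mp h'
  have hleft : ∀ x, e * x = 0 → ∀ a, a * x = 0 := by
    intro x hx a
    rw [← he a, mul_assoc, hx, mul_zero]
  have hee : e * d e = 0 := by
    have h := hd e
    rw [he, he] at h
    exact left_eq_add.mp h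
  have hN : ∀ n, e * n = 0 → e * d n = 0 := by
    intro n hn
    have h := hJ e n
    rw [hn, he, map_zero, zero_add, hleft n hn, hleft _ hee, he, zero_add, add_zero] at h
    exact right_eq_add.mp h
  have key : ∀ a, e * d a = 0 := by
    letI := auxNormed e he hcomm
    have hsm : ∀ (r : ℂ) (x y : eSub e), r • x * y = r • (x * y) := fun r x y =>
      Subtype.ext (smul_mul_assoc r (x : A) (y : A))
    have hms : ∀ (r : ℂ) (x y : eSub e), x * r • y = r • (x * y) := fun r x y =>
      Subtype.ext (mul_smul_comm r (x : A) (y : A))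
    letI : Algebra ℂ (eSub e) := Algebra.ofModule hsm hms
    letI : NormedAlgebra ℂ (eSub e) :=
      { (inferInstance : Algebra ℂ (eSub e)) with
        norm_smul_le := fun r x => norm_smul_le r (x : A) }
    have hcl : IsClosed ((eSub e : NonUnitalSubalgebra ℂ A) : Set A) := by
      have : ((eSub e : NonUnitalSubalgebra ℂ A) : Set A) = {x | e * x = x} := by
        ext x
        constructor
        · rintro ⟨a, rfl⟩
          show e * (e * a) = e * a
          rw [← mul_assoc, he]
        · intro h; exact ⟨x, h⟩
      rw [this]
      exact isClosed_eq (by fun_prop) (by fun_prop)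
    haveI : CompleteSpace (eSub e) := hcl.completeSpace_coe
    let D : eSub e →ₗ[ℂ] eSub e :=
      { toFun := fun x => ⟨e * d x, d x, rfl⟩
        map_add' := fun x y => Subtype.ext (by
          show e * d ((x : A) + y) = e * d x + e * d y
          rw [map_add, mul_add])
        map_smul' := fun r x => Subtype.ext (by
          show e * d (r • (x : A)) = r • (e * d x)
          rw [map_smul, mul_smul_comm]) }
    have hD : ∀ x y, D (x * y) = x * D y + D x * y := by
      rintro ⟨x, a, rfl⟩ ⟨y, b, rfl⟩
      apply Subtype.ext
      show e * d (e * a * (e * b)) = e * a * (e * d (e * b)) + e * d (e * a) * (e * b)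
      have h := hJ (e * a) (e * b)
      rw [← hcomm a b] at h
      have h2 := congrArg (e * ·) h
      simp only [mul_add] at h2
      have e1 : ∀ u v, e * (d u * (e * v)) = e * d u * (e * v) := fun u v => (mul_assoc _ _ _).symm
      have e2 : ∀ u v, e * (e * u * d v) = e * u * (e * d v) := fun u v => by
        rw [← mul_assoc, ← mul_assoc, he, ← mul_assoc, he]
      rw [e1, e1, e2, e2, hcomm b (d (e * a)), hcomm (d (e * b)) a] at h2
      have h3 : (2 : ℂ) • (e * d (e * a * (e * b))) =
          (2 : ℂ) • (e * a * (e * d (e * b)) + e * d (e * a) * (e * b)) := by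
        rw [two_smul, two_smul, h2]; abel
      exact smul_right_injective A (two_ne_zero (α := ℂ)) h3
    have hz := aux_main (B := eSub e) hss D hD
    intro a
    have h1 : e * d (e * a) = 0 := congrArg Subtype.val (hz ⟨e * a, a, rfl⟩)
    have h2 := hN (a - e * a) (by rw [mul_sub, ← mul_assoc, he, sub_self])
    rwa [map_sub, mul_sub, h1, sub_zero] at h2
  intro a
  have hx := hleft _ (key a)
  generalize d a = x at hx
  rw [Ideal.mem_jacobson_iff]
  intro y
  have hyx : y * (x : Unitization ℂ A) = ((y.fst • x : A) : Unitization ℂ A) := by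
    ext <;> simp [hx]
  refine ⟨1 - ((y.fst • x : A) : Unitization ℂ A), ?_⟩
  rw [Ideal.mem_bot, mul_assoc, hyx, sub_mul, one_mul, ← Unitization.inr_mul, mul_smul_comm, hx]
  simp
end

section
/- Let A be a Banach algebra with a right identity e such that the subalgebra eA = {e·a : a ∈ A} is commutative and semisimple (its Jacobson radical is zero), and let k be a positive integer. If d is a Jordan derivation of A that is k-centralizing (i.e., d(a)·aᵏ − aᵏ·d(a) ∈ Z(A) for all a ∈ A, where Z(A) is the center of A), then d = 0. -/
/-- `npowPos a n = a ^ (n + 1)`, the `(n+1)`-st power of `a` in a non-unital ring. -/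
def npowPos {A : Type*} [NonUnitalNormedRing A] (a : A) : ℕ → A
  | 0 => a
  | n + 1 => npowPos a n * a

open Filter Topology

section JohnsonSingerWermer

variable {B : Type*} [NormedCommRing B] [NormedAlgebra ℂ B] [CompleteSpace B]

/-- characters separate points of a semisimple algebra -/
lemma jsw_eq_zero_of_char (hss : (⊥ : Ideal B).jacobson = ⊥) (x : B)
    (hx : ∀ φ : B →ₐ[ℂ] ℂ, φ x = 0) : x = 0 := by
  have : x ∈ (⊥ : Ideal B).jacobson := by
    rw [Ideal.mem_jacobson_bot]
    intro y
    by_contra h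
    obtain ⟨f, hf⟩ := WeakDual.CharacterSpace.exists_apply_eq_zero h
    have h1 : (WeakDual.CharacterSpace.equivAlgHom f) (x * y + 1) = 0 := hf
    rw [map_add, map_mul, hx, map_one] at h1
    simp at h1
  rw [hss] at this
  simpa using this

/-- Singer-Wermer estimate, algebraic part -/
lemma jsw_pow (D : B →ₗ[ℂ] B) (hD : ∀ a b, D (a * b) = D a * b + a * D b) (a : B) (n : ℕ) :
    ∀ j m, m + j = n → ∃ c, (D ^ j) (a ^ n) =
      (n.descFactorial j : ℂ) • (a ^ m * (D a) ^ j) + a ^ (m + 1) * c := by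
  let D' : Derivation ℂ B B := Derivation.mk' D (by
    intro a b; rw [hD]; simp only [smul_eq_mul]; ring)
  have hpow : ∀ m, D (a ^ (m + 1)) = ((m + 1 : ℕ) : ℂ) • (a ^ m * D a) := by
    intro m
    have := D'.leibniz_pow a (m + 1)
    simp only [Nat.add_sub_cancel, smul_eq_mul] at this
    rw [Nat.cast_smul_eq_nsmul]
    exact this
  intro j
  induction j with
  | zero =>
    rintro m hm
    exact ⟨0, by simp at hm; simp [hm]⟩
  | succ j ih =>
    intro m hm
    obtain ⟨c, hc⟩ := ih (m + 1) (by omega)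
    rw [pow_succ', Module.End.mul_apply, hc, map_add, map_smul, hD, hD, hpow, hpow,
      Nat.descFactorial_succ]
    have : n - j = m + 1 := by omega
    rw [this]
    refine ⟨(n.descFactorial j : ℂ) • D (D a ^ j) + ((m + 1 + 1 : ℕ) : ℂ) • (D a * c)
      + a * D c, ?_⟩
    simp only [Algebra.smul_def, map_mul, map_natCast, Nat.cast_mul]
    ring

/-- Singer-Wermer -/
lemma jsw_singer_wermer (D : B →ₗ[ℂ] B) (hD : ∀ a b, D (a * b) = D a * b + a * D b)
    (hcont : Continuous D) (φ : B →ₐ[ℂ] ℂ) (x : B) : φ (D x) = 0 := by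
  have hD1 : D 1 = 0 := by
    have := hD 1 1
    simpa using this
  set a : B := x - algebraMap ℂ B (φ x) with ha
  have hφa : φ a = 0 := by simp [ha]
  have hDa : D a = D x := by
    rw [ha, map_sub, Algebra.algebraMap_eq_smul_one, map_smul, hD1]; simp
  rw [← hDa]
  let T : B →L[ℂ] B := ⟨D, hcont⟩
  have hT : ∀ n y, ‖(D ^ n) y‖ ≤ ‖T‖ ^ n * ‖y‖ := by
    intro n
    induction n with
    | zero => intro y; simp
    | succ n ih =>
      intro y
      rw [pow_succ', Module.End.mul_apply]
      calc ‖T ((D ^ n) y)‖ ≤ ‖T‖ * ‖(D ^ n) y‖ := T.le_opNorm _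
        _ ≤ ‖T‖ * (‖T‖ ^ n * ‖y‖) := by gcongr; exact ih y
        _ = _ := by ring
  have key : ∀ n : ℕ, 0 < n → (n.factorial : ℝ) * ‖φ (D a)‖ ^ n ≤ (‖T‖ * ‖a‖) ^ n * ‖(1 : B)‖ := by
    intro n hn
    obtain ⟨c, hc⟩ := jsw_pow D hD a n n 0 (by simp)
    have h1 : φ ((D ^ n) (a ^ n)) = (n.factorial : ℂ) * (φ (D a)) ^ n := by
      rw [hc]; simp [hφa, Nat.descFactorial_self]
    have h2 : ‖φ ((D ^ n) (a ^ n))‖ = (n.factorial : ℝ) * ‖φ (D a)‖ ^ n := by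
      rw [h1]; simp
    rw [← h2]
    calc _ ≤ ‖(D ^ n) (a ^ n)‖ * ‖(1 : B)‖ := AlgHom.norm_apply_le_self_mul_norm_one φ _
      _ ≤ (‖T‖ ^ n * ‖a ^ n‖) * ‖(1 : B)‖ := by gcongr; exact hT _ _
      _ ≤ (‖T‖ ^ n * ‖a‖ ^ n) * ‖(1 : B)‖ := by gcongr; exact norm_pow_le' a hn
      _ = _ := by ring
  by_contra hne
  have hpos : 0 < ‖φ (D a)‖ := norm_pos_iff.mpr hne
  have hlim := (FloorSemiring.tendsto_pow_div_factorial_atTop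
    (‖T‖ * ‖a‖ / ‖φ (D a)‖)).mul_const ‖(1 : B)‖
  rw [zero_mul] at hlim
  have : ∀ᶠ n : ℕ in atTop, (1 : ℝ) ≤ (‖T‖ * ‖a‖ / ‖φ (D a)‖) ^ n / n.factorial * ‖(1 : B)‖ := by
    filter_upwards [eventually_gt_atTop 0] with n hn
    have h := key n hn
    have h3 : 0 < (n.factorial : ℝ) := by positivity
    rw [div_pow, div_div, div_mul_eq_mul_div, le_div_iff₀ (by positivity)]
    linarith
  have := ge_of_tendsto hlim this
  linarith

/-- A point of `B` separating countably many characters. -/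
lemma jsw_separate (f : ℕ → (B →ₐ[ℂ] ℂ)) (hf : Function.Injective f) :
    ∃ a : B, ∀ n m, n ≠ m → f n a ≠ f m a := by
  let ι := {q : ℕ × ℕ // q.1 ≠ q.2}
  have h := dense_iInter_of_isOpen (X := B)
    (f := fun q : ι => {a : B | f q.1.1 a = f q.1.2 a}ᶜ) ?_ ?_
  · obtain ⟨a, ha⟩ := h.nonempty
    refine ⟨a, fun n m hnm => ?_⟩
    exact Set.mem_iInter.mp ha ⟨(n, m), hnm⟩
  · intro q
    exact (isClosed_eq (map_continuous _) (map_continuous _)).isOpen_compl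
  · intro q
    rw [← interior_eq_empty_iff_dense_compl]
    by_contra hne
    have hne := Set.nonempty_iff_ne_empty.mpr hne
    have := Submodule.eq_top_of_nonempty_interior'
      (LinearMap.eqLocus (f q.1.1).toLinearMap (f q.1.2).toLinearMap) hne
    apply q.2
    apply hf
    ext a
    have : a ∈ LinearMap.eqLocus (f q.1.1).toLinearMap (f q.1.2).toLinearMap := by
      rw [this]; trivial
    exact this

/-- Tail series. -/
lemma jsw_tail (u b : ℕ → B) (hu : ∀ n, ‖u n‖ ≤ 1) (hb : ∀ n, ‖b n‖ ≤ (1 / 2) ^ n) :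
    ∃ t : ℕ → B, ∀ n, t n = b n + u n * t (n + 1) := by
  let g : ℕ → ℕ → B := fun n i => (∏ j ∈ Finset.range i, u (n + j)) * b (n + i)
  have hg : ∀ i n (y : B), ‖(∏ j ∈ Finset.range i, u (n + j)) * y‖ ≤ ‖y‖ := by
    intro i
    induction i with
    | zero => intro n y; simp
    | succ i ih =>
      intro n y
      rw [Finset.prod_range_succ, mul_assoc]
      refine (ih n _).trans ((norm_mul_le _ _).trans ?_)
      have := hu (n + i)
      nlinarith [norm_nonneg y]
  have hs : ∀ n, Summable (g n) := by
    intro n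
    refine Summable.of_norm_bounded (g := fun i => (1 / 2 : ℝ) ^ i) summable_geometric_two ?_
    intro i
    refine (hg i n _).trans ((hb _).trans ?_)
    exact pow_le_pow_of_le_one (by norm_num) (by norm_num) (by omega)
  refine ⟨fun n => ∑' i, g n i, fun n => ?_⟩
  change ∑' i, g n i = b n + u n * ∑' i, g (n + 1) i
  rw [(hs n).tsum_eq_zero_add, ← (hs (n + 1)).tsum_mul_left]
  congr 1
  · simp [g]
  · congr 1
    ext i
    simp only [g, Finset.prod_range_succ']
    rw [← mul_assoc, mul_comm (u n)]
    have : ∀ j, n + 1 + j = n + (j + 1) := by intro j; omega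
    simp only [this, add_zero]

/-- Gliding hump: only finitely many characters are discontinuous along `D`. -/
lemma jsw_finite (D : B →ₗ[ℂ] B) (hD : ∀ a b, D (a * b) = D a * b + a * D b) :
    {φ : B →ₐ[ℂ] ℂ | ¬ Continuous (fun x => φ (D x))}.Finite := by
  by_contra hinf
  have hinf : Set.Infinite _ := hinf
  let F := hinf.natEmbedding
  let f : ℕ → (B →ₐ[ℂ] ℂ) := fun n => (F n).1
  have hfinj : Function.Injective f := Subtype.val_injective.comp F.injective
  have hfd : ∀ n, ¬ Continuous (fun x => f n (D x)) := fun n => (F n).2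
  obtain ⟨a, ha⟩ := jsw_separate f hfinj
  let v : ℕ → B := fun n => a - algebraMap ℂ B (f n a)
  let r : ℕ → ℂ := fun n => ((1 + ‖v n‖)⁻¹ : ℝ)
  let w : ℕ → B := fun n => r n • v n
  have hr : ∀ n, r n ≠ 0 := by
    intro n
    have : (0 : ℝ) < (1 + ‖v n‖)⁻¹ := by positivity
    exact Complex.ofReal_ne_zero.mpr this.ne'
  have hw0 : ∀ n, f n (w n) = 0 := by intro n; simp [w, v]
  have hw1 : ∀ n m, n ≠ m → f m (w n) ≠ 0 := by
    intro n m hnm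
    simp only [w, v, map_smul, map_sub, AlgHom.commutes, smul_eq_mul, Algebra.algebraMap_self,
      RingHom.id_apply]
    exact mul_ne_zero (hr n) (sub_ne_zero.mpr (ha m n hnm.symm))
  have hwn : ∀ n, ‖w n‖ ≤ 1 := by
    intro n
    have h0 := norm_nonneg (v n)
    simp only [w, r, norm_smul, Complex.norm_real, Real.norm_eq_abs]
    rw [abs_of_nonneg (by positivity), inv_mul_le_iff₀ (by positivity)]
    linarith
  let u : ℕ → B := fun n => w n * w n
  have hu : ∀ n, ‖u n‖ ≤ 1 := by
    intro n
    refine (norm_mul_le _ _).trans ?_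
    nlinarith [hwn n, norm_nonneg (w n)]
  let p : ℕ → B := fun n => ∏ i ∈ Finset.range n, u i
  have hp : ∀ n, f n (p n) ≠ 0 := by
    intro n
    simp only [p, map_prod]
    rw [Finset.prod_ne_zero_iff]
    intro i hi
    have := hw1 i n (by simp at hi; omega)
    simp only [u, map_mul]
    exact mul_ne_zero this this
  have step : ∀ (n : ℕ) (s : B), ∃ b : B, ‖b‖ ≤ (1 / 2) ^ n ∧
      (n : ℝ) ≤ ‖f n (D (s + p n * b))‖ := by
    intro n s
    by_contra! hcon
    apply hfd n
    let L : B →ₗ[ℂ] ℂ := (f n).toLinearMap.comp D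
    obtain ⟨C, hC⟩ := LinearMap.bound_of_ball_bound (𝕜 := ℂ) (r := (1 / 2) ^ n) (by positivity)
      (‖f n (p n)‖⁻¹ * (n + ‖f n (D s)‖ + ‖f n (D (p n))‖ * ‖(1 : B)‖)) L (by
      intro z hz
      have hz' : ‖z‖ ≤ (1 / 2) ^ n := by simpa using (mem_ball_zero_iff.mp hz).le
      have h1 := hcon z hz'
      have hz1 : ‖z‖ ≤ 1 := hz'.trans (pow_le_one₀ (by norm_num) (by norm_num))
      have hfz : ‖f n z‖ ≤ ‖(1 : B)‖ := by
        refine (AlgHom.norm_apply_le_self_mul_norm_one (f n) z).trans ?_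
        nlinarith [norm_nonneg (1 : B)]
      have e1 : f n (p n) * L z =
          f n (D (s + p n * z)) - f n (D s) - f n (D (p n)) * f n z := by
        simp only [L, LinearMap.comp_apply, AlgHom.toLinearMap_apply, map_add, hD, map_mul]
        ring
      rw [inv_mul_eq_div, le_div_iff₀ (norm_pos_iff.mpr (hp n)), mul_comm, ← norm_mul, e1]
      refine (norm_sub_le _ _).trans ?_
      have h2 := norm_sub_le (f n (D (s + p n * z))) (f n (D s))
      rw [norm_mul]
      have h3 : ‖f n (D (p n))‖ * ‖f n z‖ ≤ ‖f n (D (p n))‖ * ‖(1 : B)‖ := by gcongr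
      linarith)
    exact AddMonoidHomClass.continuous_of_bound L C hC
  choose β hβ1 hβ2 using step
  let s : ℕ → B := fun n => Nat.rec 0 (fun n s => s + p n * β n s) n
  have hs : ∀ n, s (n + 1) = s n + p n * β n (s n) := fun n => rfl
  obtain ⟨t, ht⟩ := jsw_tail u (fun n => β n (s n)) hu (fun n => hβ1 n (s n))
  have hx : ∀ n, t 0 = s n + p n * t n := by
    intro n
    induction n with
    | zero => simp [s, p]
    | succ n ih =>
      rw [ih, ht n, hs]
      simp only [p, Finset.prod_range_succ]
      ring
  have hfin : ∀ n : ℕ, (n : ℝ) ≤ ‖D (t 0)‖ * ‖(1 : B)‖ := by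
    intro n
    refine le_trans ?_ (AlgHom.norm_apply_le_self_mul_norm_one (f n) _)
    have : f n (D (t 0)) = f n (D (s n + p n * β n (s n))) := by
      rw [hx n, ht n]
      have : s n + p n * (β n (s n) + u n * t (n + 1)) =
        (s n + p n * β n (s n)) + w n * (w n * (p n * t (n + 1))) := by
        simp only [u]; ring
      rw [this, map_add D, map_add, hD (w n), hD (w n)]
      simp [hw0]
    rw [this]
    exact hβ2 n (s n)
  obtain ⟨n, hn⟩ := exists_nat_gt (‖D (t 0)‖ * ‖(1 : B)‖)
  exact absurd (hfin n) (not_le.mpr hn)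

/-- Johnson: automatic continuity. -/
lemma jsw_continuous (hss : (⊥ : Ideal B).jacobson = ⊥)
    (D : B →ₗ[ℂ] B) (hD : ∀ a b, D (a * b) = D a * b + a * D b) : Continuous D := by
  classical
  have hfin := jsw_finite D hD
  apply LinearMap.continuous_of_seq_closed_graph
  intro x x0 y hx hy
  rw [← sub_eq_zero]
  apply jsw_eq_zero_of_char hss
  intro φ
  by_contra hne
  set s := y - D x0 with hs
  -- continuous characters vanish on `s`
  have hvan : ∀ ψ : B →ₐ[ℂ] ℂ, Continuous (fun x => ψ (D x)) → ψ s = 0 := by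
    intro ψ hψ
    have h1 : Tendsto (fun n => ψ (D (x n))) atTop (𝓝 (ψ (D x0))) :=
      (hψ.tendsto x0).comp hx
    have h2 : Tendsto (fun n => ψ (D (x n))) atTop (𝓝 (ψ y)) :=
      ((map_continuous ψ).tendsto y).comp hy
    rw [hs, map_sub, tendsto_nhds_unique h1 h2, sub_self]
  have hφ : ¬ Continuous (fun x => φ (D x)) := fun h => hne (hvan φ h)
  -- separate `φ` from the other exceptional characters
  have hsep : ∀ ψ : B →ₐ[ℂ] ℂ, ∃ c : B, ψ ≠ φ → φ c ≠ 0 ∧ ψ c = 0 := by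
    intro ψ
    by_cases h : ψ = φ
    · exact ⟨0, fun h' => absurd h h'⟩
    · have : ∃ a, ψ a ≠ φ a := by
        by_contra! h'
        exact h (AlgHom.ext h')
      obtain ⟨a, ha⟩ := this
      refine ⟨a - algebraMap ℂ B (ψ a), fun _ => ⟨?_, ?_⟩⟩
      · simpa [sub_eq_zero] using ha.symm
      · simp
  choose c hc using hsep
  let q : B := (∏ ψ ∈ hfin.toFinset.erase φ, c ψ) * s
  have hq1 : φ q ≠ 0 := by
    simp only [q, map_mul, map_prod]
    refine mul_ne_zero (Finset.prod_ne_zero_iff.mpr ?_) hne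
    intro ψ hψ
    exact (hc ψ (Finset.ne_of_mem_erase hψ)).1
  have hq2 : ∀ ψ : B →ₐ[ℂ] ℂ, ψ ≠ φ → ψ q = 0 := by
    intro ψ hψ
    simp only [q, map_mul, map_prod]
    by_cases h : Continuous (fun x => ψ (D x))
    · rw [hvan ψ h, mul_zero]
    · rw [Finset.prod_eq_zero (i := ψ), zero_mul]
      · simp [hψ, h]
      · exact (hc ψ hψ).2
  let g : B := (φ q)⁻¹ • q
  have hg1 : φ g = 1 := by simp [g, hq1]
  have hg2 : ∀ ψ : B →ₐ[ℂ] ℂ, ψ ≠ φ → ψ g = 0 := by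
    intro ψ hψ
    simp [g, hq2 ψ hψ]
  have hmul : ∀ b, g * b = φ b • g := by
    intro b
    rw [← sub_eq_zero]
    apply jsw_eq_zero_of_char hss
    intro ψ
    by_cases h : ψ = φ
    · subst h; simp [hg1]
    · simp [hg2 ψ h]
  have hgg : g * g = g := by rw [hmul, hg1, one_smul]
  have hDg : D g = 0 := by
    have h1 := hD g g
    rw [hgg] at h1
    have h2 : g * D g = 0 := by
      have h3 : g * D g = g * (D g * g + g * D g) := by rw [← h1]
      have h4 : g * (D g * g + g * D g) = (g * g) * D g + (g * g) * D g := by ring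
      rw [h4, hgg] at h3
      simpa using h3
    rw [h1, mul_comm (D g), h2, add_zero]
  apply hφ
  have : ∀ b, φ (D b) = 0 := by
    intro b
    have h1 : D (g * b) = 0 := by rw [hmul, map_smul, hDg, smul_zero]
    rw [hD, hDg, zero_mul, zero_add] at h1
    have h2 := congrArg φ h1
    simpa [hg1] using h2
  simp only [this]
  exact continuous_const

/-- Derivations of commutative semisimple Banach algebras vanish. -/
lemma jsw_derivation_zero (hss : (⊥ : Ideal B).jacobson = ⊥)
    (D : B →ₗ[ℂ] B) (hD : ∀ a b, D (a * b) = D a * b + a * D b) (x : B) : D x = 0 :=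
  jsw_eq_zero_of_char hss _
    (fun φ => jsw_singer_wermer D hD (jsw_continuous hss D hD) φ x)

/-- Jordan derivations of commutative semisimple Banach algebras vanish. -/
lemma jsw_jordan_zero (hss : (⊥ : Ideal B).jacobson = ⊥)
    (D : B →ₗ[ℂ] B) (hD : ∀ a, D (a * a) = D a * a + a * D a) (x : B) : D x = 0 := by
  refine jsw_derivation_zero hss D (fun a b => ?_) x
  have h := hD (a + b)
  have e : (a + b) * (a + b) = a * a + b * b + (2 : ℂ) • (a * b) := by
    rw [two_smul]; ring
  rw [e, map_add, map_add, map_smul, hD, hD, map_add] at h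
  have h2 : (2 : ℂ) • D (a * b) = (2 : ℂ) • (D a * b + a * D b) := by
    rw [two_smul ℂ (D a * b + a * D b)]
    linear_combination h
  exact smul_right_injective B (two_ne_zero (α := ℂ)) h2

end JohnsonSingerWermer

lemma eSub_isClosed {A : Type*} [NonUnitalNormedRing A] [NormedSpace ℂ A]
    [IsScalarTower ℂ A A] [SMulCommClass ℂ A A] (e : A) (he : ∀ a : A, a * e = a) :
    IsClosed ((eSub e : NonUnitalSubalgebra ℂ A) : Set A) := by
  have : ((eSub e : NonUnitalSubalgebra ℂ A) : Set A) = {x | e * x = x} := by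
    ext x
    constructor
    · rintro ⟨a, rfl⟩
      change e * (e * a) = e * a
      rw [← mul_assoc, he]
    · intro hx
      exact ⟨x, hx⟩
  rw [this]
  exact isClosed_eq (continuous_const.mul continuous_id) continuous_id

/-- The induced derivation on `eA` vanishes. -/
lemma eSub_jordan_zero
    {A : Type*} [NonUnitalNormedRing A] [NormedSpace ℂ A]
    [IsScalarTower ℂ A A] [SMulCommClass ℂ A A] [CompleteSpace A]
    (e : A) (he : ∀ a : A, a * e = a)
    (hcomm : ∀ a b : A, (e * a) * (e * b) = (e * b) * (e * a))
    (hss : letI : Ring (eSub e) := eRing e he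
           (⊥ : Ideal (eSub e)).jacobson = ⊥)
    (d : A →ₗ[ℂ] A) (hd : ∀ a : A, d (a * a) = d a * a + a * d a) (a : A) :
    e * d (e * a) = 0 := by
  letI iN : NormedCommRing (eSub e) :=
    { (inferInstance : NonUnitalNormedRing (eSub e)), eRing e he with
      mul_comm := by
        rintro ⟨x, a, rfl⟩ ⟨y, b, rfl⟩
        ext
        exact hcomm a b }
  letI iA : NormedAlgebra ℂ (eSub e) :=
    { Algebra.ofModule (R := ℂ) (A := eSub e)
        (fun r x y => Subtype.ext (smul_mul_assoc r (x : A) (y : A)))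
        (fun r x y => Subtype.ext (mul_smul_comm r (x : A) (y : A))) with
      norm_smul_le := fun r x => norm_smul_le r (x : A) }
  haveI : CompleteSpace (eSub e) := (eSub_isClosed e he).completeSpace_coe
  let D : eSub e →ₗ[ℂ] eSub e :=
    { toFun := fun x => ⟨e * d x, d x, rfl⟩
      map_add' := fun x y => Subtype.ext (by
        change e * d ((x : A) + y) = e * d x + e * d y
        rw [map_add, mul_add])
      map_smul' := fun r x => Subtype.ext (by
        change e * d (r • (x : A)) = r • (e * d x)
        rw [map_smul, mul_smul_comm]) }
  have h := jsw_jordan_zero (B := eSub e) hss D (by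
    intro x
    apply Subtype.ext
    change e * d ((x : A) * x) = (e * d x) * x + x * (e * d x)
    obtain ⟨x, b, rfl⟩ := x
    change e * d ((e * b) * (e * b)) = (e * d (e * b)) * (e * b) + (e * b) * (e * d (e * b))
    rw [hd, mul_add, ← mul_assoc (e * b) e, he (e * b), ← mul_assoc e (e * b), ← mul_assoc e e b,
      he e, mul_assoc e (d (e * b))]) ⟨e * a, a, rfl⟩
  exact congrArg Subtype.val h

theorem k_centralizing_jordanDerivation_eq_zero
    {A : Type*} [NonUnitalNormedRing A] [NormedSpace ℂ A]
    [IsScalarTower ℂ A A] [SMulCommClass ℂ A A] [CompleteSpace A]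
    (e : A) (he : ∀ a : A, a * e = a)
    (hcomm : ∀ a b : A, (e * a) * (e * b) = (e * b) * (e * a))
    (hss : letI : Ring (eSub e) := eRing e he
           (⊥ : Ideal (eSub e)).jacobson = ⊥)
    (d : A →ₗ[ℂ] A) (hd : ∀ a : A, d (a * a) = d a * a + a * d a)
    (k : ℕ) (hk : 0 < k)
    (hcent : ∀ a b : A,
      (d a * npowPos a (k - 1) - npowPos a (k - 1) * d a) * b =
        b * (d a * npowPos a (k - 1) - npowPos a (k - 1) * d a)) :
    ∀ a : A, d a = 0 := by
  have hB := eSub_jordan_zero e he hcomm hss d hd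
  -- everything killed by `e` on the left is killed by everything on the left
  have hN : ∀ x y : A, e * x = 0 → y * x = 0 := by
    intro x y hx
    rw [← he y, mul_assoc, hx, mul_zero]
  -- linearized Jordan identity
  have hJ : ∀ a b : A, d (a * b) + d (b * a) = d a * b + a * d b + (d b * a + b * d a) := by
    intro a b
    have h := hd (a + b)
    simp only [add_mul, mul_add, map_add, hd] at h
    have h' := sub_eq_zero.mpr h
    rw [← sub_eq_zero, ← h']
    abel
  have hee : e * e = e := he e
  have hde : e * d e = 0 := by have := hB e; rwa [hee] at this
  -- `d` maps the kernel of `e` into itself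
  have hdN : ∀ n : A, e * n = 0 → e * d n = 0 := by
    intro n hn
    have h := hJ n e
    rw [he, hn, map_zero, he, hN (d e) n hde, hN n (d e) hn] at h
    simpa using h
  have hall : ∀ a : A, e * d a = 0 := by
    intro a
    have h1 : e * (a - e * a) = 0 := by rw [mul_sub, ← mul_assoc, hee, sub_self]
    have h2 := hdN _ h1
    rw [map_sub, mul_sub, hB a, sub_zero] at h2
    exact h2
  -- the centralizing condition
  have hpow : ∀ a : A, e * a = e → ∀ n, e * npowPos a n = e := by
    intro a ha n
    induction n with
    | zero => exact ha
    | succ n ih =>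
      change e * (npowPos a n * a) = e
      rw [← mul_assoc, ih, ha]
  have hone : ∀ a : A, e * a = e → d a = 0 := by
    intro a ha
    have h := hcent a e
    rw [hN (d a) _ (hall a), sub_zero, he, ← mul_assoc, hall a, zero_mul] at h
    rw [← he (d a), mul_assoc, hpow a ha] at h
    rwa [he] at h
  have hde0 : d e = 0 := hone e hee
  intro a
  have h1 : e * (e + (a - e * a)) = e := by
    rw [mul_add, mul_sub, ← mul_assoc, hee, sub_self, add_zero]
  have h2 := hone _ h1
  rw [map_add, hde0, zero_add, map_sub, sub_eq_zero] at h2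
  have h3 := hJ e (e * a)
  rw [← mul_assoc, hee, he, hde0, zero_mul, mul_zero, hall, he] at h3
  rw [h2]
  simpa using h3
end

section
/- Let A be a Banach algebra such that the quotient A/ran(A) by the right annihilator is commutative and semisimple (its Jacobson radical is zero). Then every derivation of A maps A into ran(A), and ran(A) ⊆ rad(A), the Jacobson radical of A. -/
/-- The right annihilator `ran(A) = {x | ∀ a, a * x = 0}` of `A`, as a two-sided ideal. -/
def ranIdeal (A : Type*) [NonUnitalNormedRing A] : TwoSidedIdeal A :=
  TwoSidedIdeal.mk' {x | ∀ a : A, a * x = 0}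
    (fun a => mul_zero a)
    (fun hx hy a => by rw [mul_add, hx a, hy a, add_zero])
    (fun hx a => by rw [mul_neg, hx a, neg_zero])
    (fun {x y} hy a => by rw [← mul_assoc, hy (a * x)])
    (fun {x y} hx a => by rw [← mul_assoc, hx a, zero_mul])

/-- The quotient algebra `A / ran(A)`. -/
abbrev RanQuot (A : Type*) [NonUnitalNormedRing A] := (ranIdeal A).ringCon.Quotient


section Helpers

set_option linter.unusedSectionVars false

variable {A : Type*} [NonUnitalNormedRing A]

lemma ranQuot_eq_zero_iff (x : A) :
    ((x : RanQuot A) = 0) ↔ ∀ a : A, a * x = 0 := by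
  have h : ((x : RanQuot A) = ((0 : A) : RanQuot A)) ↔ x ∈ ranIdeal A := by
    rw [RingCon.eq, TwoSidedIdeal.mem_iff]
  have h2 : ((0 : A) : RanQuot A) = 0 := rfl
  rw [← h2, h, ranIdeal, TwoSidedIdeal.mem_mk']
  rfl

variable [NormedSpace ℂ A] [IsScalarTower ℂ A A] [SMulCommClass ℂ A A]

/-- Multiplicative continuous functionals (the zero functional is allowed). -/
def IsMulFunctional (φ : A →L[ℂ] ℂ) : Prop := ∀ x y, φ (x * y) = φ x * φ y

lemma exists_quasi_inverse [CompleteSpace A]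
    (hR : ∀ x y a : A, a * (x * y) = a * (y * x)) (a : A)
    (h : ∀ φ : A →L[ℂ] ℂ, IsMulFunctional φ → φ a = 0) :
    ∃ w : A, w + a + w * a = 0 := by
  let R : A →L[ℂ] (A →L[ℂ] A) := (ContinuousLinearMap.mul ℂ A).flip
  have hRa : ∀ x y, R x y = y * x := fun x y => rfl
  have hRm : ∀ x y, R (x * y) = R x * R y := by
    intro x y
    ext z
    change z * (x * y) = (z * y) * x
    rw [hR, mul_assoc]
  have hRc : ∀ x y, R x * R y = R y * R x := by
    intro x y
    ext z
    change (z * y) * x = (z * x) * y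
    rw [mul_assoc, mul_assoc, hR]
  let S : Set (A →L[ℂ] A) := Set.range R
  let C : Subalgebra ℂ (A →L[ℂ] A) :=
    Subalgebra.centralizer ℂ (Subalgebra.centralizer ℂ S : Set (A →L[ℂ] A))
  have hSC : ∀ x, R x ∈ C := by
    intro x
    rw [Subalgebra.mem_centralizer_iff]
    intro g hg
    exact ((Subalgebra.mem_centralizer_iff ℂ).1 hg (R x) ⟨x, rfl⟩).symm
  have hCS : ∀ g ∈ C, g ∈ Subalgebra.centralizer ℂ S := by
    intro g hg
    rw [Subalgebra.mem_centralizer_iff]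
    rintro _ ⟨x, rfl⟩
    refine (Subalgebra.mem_centralizer_iff ℂ).1 hg (R x) ?_
    refine (Subalgebra.mem_centralizer_iff ℂ).2 ?_
    rintro _ ⟨y, rfl⟩
    exact hRc y x
  have hcomm : ∀ x y : C, x * y = y * x := by
    rintro ⟨x, hx⟩ ⟨y, hy⟩
    apply Subtype.ext
    exact (Subalgebra.mem_centralizer_iff ℂ).1 hy x (hCS x hx)
  have hclosed : IsClosed (C : Set (A →L[ℂ] A)) := Set.isClosed_centralizer _
  let _ : NormedCommRing C := { (inferInstance : NormedRing C) with mul_comm := hcomm }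
  let _ : NormedAlgebra ℂ C := Subalgebra.toNormedAlgebra C
  have : CompleteSpace C := hclosed.completeSpace_coe
  let RC : A →L[ℂ] C := R.codRestrict (Subalgebra.toSubmodule C) hSC
  have hRCm : ∀ x y, RC (x * y) = RC x * RC y := fun x y => Subtype.ext (hRm x y)
  have hu : IsUnit (1 + RC a) := by
    by_contra hn
    obtain ⟨f, hf⟩ := WeakDual.CharacterSpace.exists_apply_eq_zero hn
    let φ : A →L[ℂ] ℂ := (WeakDual.toStrongDual (f : WeakDual ℂ C)).comp RC
    have hφ : ∀ x, φ x = f (RC x) := fun x => rfl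
    have h0 := h φ (by
      intro x y
      rw [hφ, hφ, hφ, hRCm, map_mul])
    rw [map_add, map_one, ← hφ, h0] at hf
    simp at hf
  obtain ⟨v, hv⟩ := hu.exists_right_inv
  have hv2 : (1 + R a) * (v : A →L[ℂ] A) = 1 := congrArg Subtype.val hv
  have h3 := congrArg (fun T : A →L[ℂ] A => T (-a)) hv2
  refine ⟨(v : A →L[ℂ] A) (-a), ?_⟩
  simp only [mul_apply_eq_comp, add_apply,
    one_apply_eq_self, hRa] at h3
  rw [add_right_comm, h3, neg_add_cancel]

lemma mem_ran_of_functionals [CompleteSpace A]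
    (hcomm : ∀ x y : RanQuot A, x * y = y * x)
    (hss : ∀ x : RanQuot A,
      (↑x : Unitization ℤ (RanQuot A)) ∈ (⊥ : Ideal (Unitization ℤ (RanQuot A))).jacobson →
        x = 0) (x : A)
    (h : ∀ φ : A →L[ℂ] ℂ, IsMulFunctional φ → φ x = 0) : ∀ a : A, a * x = 0 := by
  have hR : ∀ x y a : A, a * (x * y) = a * (y * x) := by
    intro x y a
    have h1 : ((x * y - y * x : A) : RanQuot A) = 0 := by
      have := hcomm x y
      rw [← sub_eq_zero] at this
      exact this
    rw [ranQuot_eq_zero_iff] at h1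
    have := h1 a
    rwa [mul_sub, sub_eq_zero] at this
  rw [← ranQuot_eq_zero_iff]
  apply hss
  rw [Ideal.mem_jacobson_iff]
  intro y
  obtain ⟨n, b, rfl⟩ : ∃ (n : ℤ) (b : RanQuot A),
      y = Unitization.inl n + (b : Unitization ℤ (RanQuot A)) :=
    ⟨y.fst, y.snd, (Unitization.inl_fst_add_inr_snd_eq y).symm⟩
  obtain ⟨b, rfl⟩ := Quotient.exists_rep b
  obtain ⟨w, hw⟩ := exists_quasi_inverse hR (n • x + b * x) (by
    intro φ hφ
    rw [map_add, hφ, map_zsmul, h φ hφ]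
    simp)
  refine ⟨1 + ((w : RanQuot A) : Unitization ℤ (RanQuot A)), ?_⟩
  have hw2 : (w : RanQuot A) + (n • (x : RanQuot A) + (b : RanQuot A) * (x : RanQuot A))
    + (w : RanQuot A) * (n • (x : RanQuot A) + (b : RanQuot A) * (x : RanQuot A)) = 0 :=
    congrArg (fun z : A => (z : RanQuot A)) hw
  have hyx : (Unitization.inl n + ((b : RanQuot A) : Unitization ℤ (RanQuot A))) *
      ((x : RanQuot A) : Unitization ℤ (RanQuot A)) =
      ((n • (x : RanQuot A) + (b : RanQuot A) * (x : RanQuot A) : RanQuot A) :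
        Unitization ℤ (RanQuot A)) := by
    rw [add_mul, Unitization.inr_add, Unitization.inr_mul, Unitization.inl_mul_inr]
  change (1 + ((w : RanQuot A) : Unitization ℤ (RanQuot A))) *
    (Unitization.inl n + ((b : RanQuot A) : Unitization ℤ (RanQuot A))) *
      ((x : RanQuot A) : Unitization ℤ (RanQuot A)) +
      (1 + ((w : RanQuot A) : Unitization ℤ (RanQuot A))) - 1 ∈ _
  rw [mul_assoc, hyx, add_mul, one_mul, ← Unitization.inr_mul, Ideal.mem_bot]
  have h4 := congrArg (fun z : RanQuot A => (z : Unitization ℤ (RanQuot A))) hw2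
  simp only [Unitization.inr_add, Unitization.inr_zero] at h4 ⊢
  rw [← h4]
  abel

lemma ran_mem_jacobson (r : A) (hr : ∀ a : A, a * r = 0) :
    (↑r : Unitization ℂ A) ∈ (⊥ : Ideal (Unitization ℂ A)).jacobson := by
  rw [Ideal.mem_jacobson_iff]
  intro y
  obtain ⟨n, b, rfl⟩ : ∃ (n : ℂ) (b : A), y = Unitization.inl n + (b : Unitization ℂ A) :=
    ⟨y.fst, y.snd, (Unitization.inl_fst_add_inr_snd_eq y).symm⟩
  refine ⟨1 - ((n • r : A) : Unitization ℂ A), ?_⟩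
  have hyx : (Unitization.inl n + (b : Unitization ℂ A)) * (r : Unitization ℂ A) =
      ((n • r : A) : Unitization ℂ A) := by
    rw [add_mul, ← Unitization.inr_mul, hr, Unitization.inl_mul_inr, Unitization.inr_zero,
      add_zero]
  rw [mul_assoc, hyx, sub_mul, one_mul, ← Unitization.inr_mul, mul_smul_comm, hr, Ideal.mem_bot]
  simp

lemma exists_tail_seq {E : Type*} [NormedAddCommGroup E] [NormedSpace ℂ E] [CompleteSpace E]
    (T : ℕ → E →L[ℂ] E) (hT : ∀ n, ‖T n‖ ≤ 1) (x : ℕ → E)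
    (hx : ∀ n, ‖x n‖ ≤ (1 / 2 : ℝ) ^ n) :
    ∃ y : ℕ → E, (∀ n, y n = x n + T n (y (n + 1))) ∧ ∀ n, ‖y n‖ ≤ 2 := by
  let M : ℕ → ℕ → E →L[ℂ] E := fun j => Nat.rec (fun _ => ContinuousLinearMap.id ℂ E)
    (fun _ f n => (T n).comp (f (n + 1))) j
  have hM0 : ∀ n z, M 0 n z = z := fun _ _ => rfl
  have hMs : ∀ j n z, M (j + 1) n z = T n (M j (n + 1) z) := fun _ _ _ => rfl
  have hTn : ∀ n z, ‖T n z‖ ≤ ‖z‖ := fun n z => by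
    simpa using (T n).le_of_opNorm_le (hT n) z
  have hMn : ∀ j n z, ‖M j n z‖ ≤ ‖z‖ := by
    intro j
    induction j with
    | zero => intro n z; rw [hM0]
    | succ j ih => intro n z; rw [hMs]; exact (hTn _ _).trans (ih _ _)
  have hb : ∀ n j, ‖M j n (x (n + j))‖ ≤ (1 / 2 : ℝ) ^ j := by
    intro n j
    refine (hMn _ _ _).trans ((hx _).trans ?_)
    exact pow_le_pow_of_le_one (by norm_num) (by norm_num) (by omega)
  have hs : ∀ n, Summable fun j => M j n (x (n + j)) := fun n =>
    Summable.of_norm_bounded summable_geometric_two (hb n)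
  refine ⟨fun n => ∑' j, M j n (x (n + j)), fun n => ?_, fun n => ?_⟩
  · change (∑' j, M j n (x (n + j))) = x n + T n (∑' j, M j (n + 1) (x (n + 1 + j)))
    rw [(hs n).tsum_eq_zero_add, (T n).map_tsum (hs (n + 1))]
    congr 1
    refine tsum_congr fun j => ?_
    rw [hMs]
    congr 3
    omega
  · exact tsum_of_norm_bounded hasSum_geometric_two (hb n)

lemma functional_separation {φ ψ : A →L[ℂ] ℂ} (hφ : IsMulFunctional φ) (hψ : IsMulFunctional ψ)
    (hne : φ ≠ ψ) (hψ0 : ψ ≠ 0) : ∃ b, φ b = 0 ∧ ψ b ≠ 0 := by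
  by_contra! hc
  obtain ⟨u, hu⟩ : ∃ u, ψ u ≠ 0 := by
    by_contra! h
    exact hψ0 (ContinuousLinearMap.ext h)
  have hφu : φ u ≠ 0 := fun h => hu (hc u h)
  have key : ∀ x, ψ x * φ u = φ x * ψ u := by
    intro x
    have := hc (φ u • x - φ x • u) (by simp [mul_comm])
    simp only [map_sub, map_smul, smul_eq_mul, sub_eq_zero] at this
    linear_combination this
  have h1 := key (u * u)
  rw [hφ, hψ] at h1
  have h2 : ψ u = φ u := by
    have : φ u * ψ u * (ψ u - φ u) = 0 := by linear_combination h1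
    rcases mul_eq_zero.1 this with h | h
    · exact absurd h (mul_ne_zero hφu hu)
    · exact sub_eq_zero.1 h
  apply hne
  ext x
  have := key x
  rw [h2] at this
  exact (mul_right_cancel₀ hφu this).symm

lemma exists_common_separator [CompleteSpace A] (φ : A →L[ℂ] ℂ) (ψ : ℕ → A →L[ℂ] ℂ)
    (h : ∀ n, ∃ b, φ b = 0 ∧ ψ n b ≠ 0) :
    ∃ b : A, ‖b‖ ≤ 1 ∧ φ b = 0 ∧ ∀ n, ψ n b ≠ 0 := by
  let E : Submodule ℂ A := LinearMap.ker (φ : A →ₗ[ℂ] ℂ)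
  have hE : ∀ x, x ∈ E ↔ φ x = 0 := fun x => Iff.rfl
  have hcl : IsClosed (E : Set A) := φ.isClosed_ker
  have : CompleteSpace E := hcl.completeSpace_coe
  let χ : ℕ → E →L[ℂ] ℂ := fun n => (ψ n).comp E.subtypeL
  have hd : Dense (⋂ n, {x : E | χ n x ≠ 0}) := by
    apply dense_iInter_of_isOpen
    · intro n
      exact isOpen_ne_fun (χ n).continuous continuous_const
    · intro n
      have : {x : E | χ n x ≠ 0} = ((LinearMap.ker (χ n : E →ₗ[ℂ] ℂ) : Submodule ℂ E) : Set E)ᶜ := by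
        ext x; simp
      rw [this, ← interior_eq_empty_iff_dense_compl]
      by_contra hne
      have htop := Submodule.eq_top_of_nonempty_interior' _ (Set.nonempty_iff_ne_empty.2 hne)
      obtain ⟨b, hb, hb2⟩ := h n
      have hm : (⟨b, hb⟩ : E) ∈ LinearMap.ker (χ n : E →ₗ[ℂ] ℂ) := by rw [htop]; trivial
      exact hb2 hm
  obtain ⟨⟨b, hb⟩, hb2⟩ := hd.nonempty
  rw [Set.mem_iInter] at hb2
  have hpos : (0 : ℝ) < ‖b‖ + 1 := by positivity
  have hc : ((‖b‖ + 1 : ℝ) : ℂ)⁻¹ ≠ 0 := inv_ne_zero (by exact_mod_cast hpos.ne')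
  refine ⟨((‖b‖ + 1 : ℝ) : ℂ)⁻¹ • b, ?_, ?_, fun n => ?_⟩
  · rw [norm_smul, norm_inv, Complex.norm_real, Real.norm_of_nonneg hpos.le, inv_mul_le_iff₀ hpos]
    linarith
  · rw [map_smul, (hE b).1 hb, smul_zero]
  · rw [map_smul]
    exact smul_ne_zero hc (hb2 n)

lemma unbounded_of_not_continuous {E : Type*} [NormedAddCommGroup E] [NormedSpace ℂ E]
    (f : E →ₗ[ℂ] ℂ) (hf : ¬ Continuous f) (K : ℝ) (ε : ℝ) (hε : 0 < ε) :
    ∃ x, ‖x‖ ≤ ε ∧ K ≤ ‖f x‖ := by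
  by_contra! hc
  apply hf
  have hK : ∀ x, ‖x‖ ≤ ε → ‖f x‖ ≤ K := fun x hx => (hc x hx).le
  refine AddMonoidHomClass.continuous_of_bound f (K / ε) fun x => ?_
  by_cases hx : x = 0
  · simp [hx]
  have hxn : 0 < ‖x‖ := norm_pos_iff.2 hx
  have h1 := hK (((ε / ‖x‖ : ℝ) : ℂ) • x) (by
    rw [norm_smul, Complex.norm_real, Real.norm_of_nonneg (by positivity)]
    field_simp; rfl)
  rw [map_smul, norm_smul, Complex.norm_real, Real.norm_of_nonneg (by positivity)] at h1
  rw [div_mul_eq_mul_div, le_div_iff₀ hε]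
  rw [div_mul_eq_mul_div, div_le_iff₀ hxn] at h1
  linarith

lemma finite_discontinuous [CompleteSpace A] (d : A →ₗ[ℂ] A)
    (hd : ∀ a x : A, d (a * x) = d a * x + a * d x) :
    {φ : A →L[ℂ] ℂ | IsMulFunctional φ ∧ ¬ Continuous fun x => φ (d x)}.Finite := by
  by_contra hinf
  let e := Set.Infinite.natEmbedding _ hinf
  let φ : ℕ → A →L[ℂ] ℂ := fun n => (e n : A →L[ℂ] ℂ)
  have hφm : ∀ n, IsMulFunctional (φ n) := fun n => (e n).2.1
  have hφd : ∀ n, ¬ Continuous fun x => φ n (d x) := fun n => (e n).2.2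
  have hφ0 : ∀ n, φ n ≠ 0 := by
    intro n h0
    apply hφd n
    rw [h0]
    simpa using continuous_const
  have hφi : ∀ n m, n ≠ m → φ n ≠ φ m := fun n m hnm h => hnm (e.injective (Subtype.ext h))
  -- the separating elements
  have hb : ∀ n, ∃ b : A, ‖b‖ ≤ 1 ∧ φ n b = 0 ∧ ∀ m, n < m → φ m b ≠ 0 := by
    intro n
    obtain ⟨b, h1, h2, h3⟩ := exists_common_separator (φ n) (fun k => φ (n + 1 + k)) (fun k =>
      functional_separation (hφm _) (hφm _) (hφi _ _ (by omega)) (hφ0 _))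
    refine ⟨b, h1, h2, fun m hm => ?_⟩
    have := h3 (m - (n + 1))
    rwa [show n + 1 + (m - (n + 1)) = m by omega] at this
  choose b hb1 hb0 hbne using hb
  let T : ℕ → A →L[ℂ] A := fun n => ContinuousLinearMap.mul ℂ A (b n)
  have hTa : ∀ n x, T n x = b n * x := fun _ _ => rfl
  have hT : ∀ n, ‖T n‖ ≤ 1 := fun n =>
    (ContinuousLinearMap.opNorm_mul_apply_le ℂ A (b n)).trans (hb1 n)
  obtain ⟨L, hL0, hLs⟩ : ∃ L : ℕ → A →L[ℂ] A, (∀ x, L 0 x = x) ∧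
      ∀ n x, L (n + 1) x = L n (b n * x) :=
    ⟨fun n => Nat.rec (ContinuousLinearMap.id ℂ A) (fun n f => f.comp (T n)) n,
      fun _ => rfl, fun _ _ => rfl⟩
  have hK : ∀ n, ∃ K : A →L[ℂ] A, ∀ x, d (L n x) = L n (d x) + K x := by
    intro n
    induction n with
    | zero => exact ⟨0, fun x => by simp [hL0]⟩
    | succ n ih =>
      obtain ⟨K, hK⟩ := ih
      refine ⟨(L n).comp (ContinuousLinearMap.mul ℂ A (d (b n))) + K.comp (T n), fun x => ?_⟩
      simp only [hLs, hK, hd, map_add, add_apply, ContinuousLinearMap.comp_apply, hTa,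
        ContinuousLinearMap.mul_apply']
      abel
  choose K hK using hK
  have hLφ : ∀ n m, ∃ c : ℂ, (∀ x, φ m (L n x) = c * φ m x) ∧ (n ≤ m → c ≠ 0) ∧
      (m < n → c = 0) := by
    intro n m
    induction n with
    | zero => exact ⟨1, fun x => by simp [hL0], fun _ => one_ne_zero, fun h => by omega⟩
    | succ n ih =>
      obtain ⟨c, h1, h2, h3⟩ := ih
      refine ⟨c * φ m (b n), fun x => ?_, fun h => ?_, fun h => ?_⟩
      · rw [hLs, h1, hφm, mul_assoc]
      · exact mul_ne_zero (h2 (by omega)) (hbne n m (by omega))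
      · rcases Nat.lt_succ_iff_lt_or_eq.1 h with h | h
        · rw [h3 h, zero_mul]
        · rw [h, hb0, mul_zero]
  have hC : ∀ n, ∃ C : ℝ, ∀ y, ‖y‖ ≤ 2 → ‖φ n (d (L (n + 1) y))‖ ≤ C := by
    intro n
    refine ⟨‖(φ n).comp (K (n + 1))‖ * 2, fun y hy => ?_⟩
    obtain ⟨c, h1, -, h3⟩ := hLφ (n + 1) n
    rw [hK, map_add, h1, h3 (by omega), zero_mul, zero_add]
    exact ((φ n).comp (K (n + 1))).le_opNorm_of_le hy
  choose C hC using hC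
  have hX : ∀ n (s : A), ∃ x : A, ‖x‖ ≤ (1 / 2 : ℝ) ^ n ∧
      n * ‖φ n‖ + ‖φ n (d s)‖ + C n ≤ ‖φ n (d (L n x))‖ := by
    intro n s
    refine unbounded_of_not_continuous ((φ n : A →ₗ[ℂ] ℂ) ∘ₗ d ∘ₗ (L n : A →ₗ[ℂ] A)) ?_ _
      ((1 / 2 : ℝ) ^ n) (by positivity)
    intro hcont
    obtain ⟨c, h1, h2, -⟩ := hLφ n n
    apply hφd n
    have hc := h2 le_rfl
    have h4 : (fun x => φ n (d x)) = fun x => c⁻¹ *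
        (((φ n : A →ₗ[ℂ] ℂ) ∘ₗ d ∘ₗ (L n : A →ₗ[ℂ] A)) x - φ n (K n x)) := by
      funext x
      simp only [LinearMap.comp_apply, ContinuousLinearMap.coe_coe]
      rw [hK, map_add, h1]
      field_simp
      ring
    rw [h4]
    exact continuous_const.mul (hcont.sub ((φ n).continuous.comp (K n).continuous))
  choose X hX1 hX2 using hX
  let s : ℕ → A := fun n => Nat.rec 0 (fun n s => s + L n (X n s)) n
  have hs0 : s 0 = 0 := rfl
  have hss : ∀ n, s (n + 1) = s n + L n (X n (s n)) := fun _ => rfl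
  obtain ⟨y, hy1, hy2⟩ := exists_tail_seq T hT (fun n => X n (s n)) (fun n => hX1 _ _)
  have hsy : ∀ n, y 0 = s n + L n (y n) := by
    intro n
    induction n with
    | zero => rw [hs0, hL0, zero_add]
    | succ n ih => rw [ih, hss, hy1 n, map_add, hLs, hTa, add_assoc]
  obtain ⟨n, hn⟩ := exists_nat_gt ‖d (y 0)‖
  have e1 : φ n (d (y 0)) = φ n (d (s n)) + φ n (d (L n (X n (s n)))) +
      φ n (d (L (n + 1) (y (n + 1)))) := by
    rw [hsy (n + 1), hss]
    simp only [map_add]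
  have e2 := hX2 n (s n)
  have e3 := hC n _ (hy2 (n + 1))
  have e4 := (φ n).le_opNorm (d (y 0))
  have e5 : ‖φ n (d (L n (X n (s n))))‖ ≤ ‖φ n (d (y 0))‖ + ‖φ n (d (s n))‖ +
      ‖φ n (d (L (n + 1) (y (n + 1))))‖ := by
    have : φ n (d (L n (X n (s n)))) = φ n (d (y 0)) - φ n (d (s n)) -
      φ n (d (L (n + 1) (y (n + 1)))) := by rw [e1]; ring
    rw [this]
    exact (norm_sub_le _ _).trans (add_le_add_left (norm_sub_le _ _) _)
  have e6 : 0 < ‖φ n‖ := norm_pos_iff.2 (hφ0 n)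
  nlinarith

lemma exists_isolating (F : Finset (A →L[ℂ] ℂ)) (hF : ∀ ψ ∈ F, IsMulFunctional ψ)
    (φ : A →L[ℂ] ℂ) (hφ : IsMulFunctional φ) (s : A) (hs : φ s ≠ 0) :
    ∃ t, φ t ≠ 0 ∧ (∀ ψ, IsMulFunctional ψ → ψ s = 0 → ψ t = 0) ∧ ∀ ψ ∈ F, ψ ≠ φ → ψ t = 0 := by
  classical
  induction F using Finset.induction_on with
  | empty => exact ⟨s, hs, fun _ _ h => h, by simp⟩
  | insert χ F hχ ih =>
    obtain ⟨t, h1, h2, h3⟩ := ih (fun ψ h => hF ψ (Finset.mem_insert_of_mem h))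
    by_cases hc : χ = φ
    · refine ⟨t, h1, h2, fun ψ hψ hne => ?_⟩
      rcases Finset.mem_insert.1 hψ with h | h
      · exact absurd (h.trans hc) hne
      · exact h3 ψ h hne
    · have hφ0 : φ ≠ 0 := by
        rintro rfl
        simp at hs
      obtain ⟨u, hu1, hu2⟩ := functional_separation (hF χ (Finset.mem_insert_self _ _)) hφ hc hφ0
      refine ⟨t * u, ?_, fun ψ hψ h => ?_, fun ψ hψ hne => ?_⟩
      · rw [hφ]; exact mul_ne_zero h1 hu2
      · rw [hψ, h2 ψ hψ h, zero_mul]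
      · rw [hF ψ hψ]
        rcases Finset.mem_insert.1 hψ with h | h
        · rw [h, hu1, mul_zero]
        · rw [h3 ψ h hne, zero_mul]

/-- If all functionals with continuous `φ ∘ d` vanish at `s`, then all functionals do. -/
lemma vanish_of_vanish_continuous [CompleteSpace A] (d : A →ₗ[ℂ] A)
    (hd : ∀ a x : A, d (a * x) = d a * x + a * d x)
    (hN : ∀ x : A, (∀ φ : A →L[ℂ] ℂ, IsMulFunctional φ → φ x = 0) →
      ∀ φ : A →L[ℂ] ℂ, IsMulFunctional φ → φ (d x) = 0)
    (s : A) (hs : ∀ φ : A →L[ℂ] ℂ, IsMulFunctional φ → (Continuous fun x => φ (d x)) → φ s = 0)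
    (φ : A →L[ℂ] ℂ) (hφ : IsMulFunctional φ) : φ s = 0 := by
  by_contra hne
  have hfin := finite_discontinuous d hd
  have hdisc : ¬ Continuous fun x => φ (d x) := fun h => hne (hs φ hφ h)
  obtain ⟨t, h1, h2, h3⟩ := exists_isolating hfin.toFinset
    (fun ψ h => ((Set.Finite.mem_toFinset _).1 h).1) φ hφ s hne
  have ht : ∀ ψ : A →L[ℂ] ℂ, IsMulFunctional ψ → ψ ≠ φ → ψ t = 0 := by
    intro ψ hψ hne
    by_cases hc : Continuous fun x => ψ (d x)
    · exact h2 ψ hψ (hs ψ hψ hc)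
    · exact h3 ψ ((Set.Finite.mem_toFinset _).2 ⟨hψ, hc⟩) hne
  have k1 : ∀ a, φ (d (t * a - φ a • t)) = 0 := by
    intro a
    refine hN _ (fun ψ hψ => ?_) φ hφ
    by_cases hc : ψ = φ
    · subst hc
      rw [map_sub, hφ, map_smul, smul_eq_mul]; ring
    · rw [map_sub, hψ, map_smul, ht ψ hψ hc]; simp
  have k2 : ∀ a, φ (d a) * φ t = 0 := by
    intro a
    have := k1 a
    rw [map_sub, hd, map_sub, map_add, hφ, hφ, map_smul, map_smul, smul_eq_mul] at this
    linear_combination this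
  apply hdisc
  have : (fun x => φ (d x)) = fun _ => 0 := by
    funext x
    exact (mul_eq_zero.1 (k2 x)).resolve_right h1
  rw [this]
  exact continuous_const

lemma leibniz_iterate (d : A →ₗ[ℂ] A) (hd : ∀ a x : A, d (a * x) = d a * x + a * d x)
    (a b : A) (n : ℕ) : d^[n] (a * b) =
      ∑ ij ∈ Finset.HasAntidiagonal.antidiagonal n, n.choose ij.1 • (d^[ij.1] a * d^[ij.2] b) := by
  induction n with
  | zero => simp
  | succ n ih =>
    rw [Finset.sum_antidiagonal_choose_succ_nsmul (M := A) (fun i j => d^[i] a * d^[j] b) n]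
    simp only [Function.iterate_succ_apply', ih, map_sum, map_nsmul, hd, smul_add,
      Finset.sum_add_distrib]
    rw [add_comm, add_right_inj]
    refine Finset.sum_congr rfl fun ⟨i, j⟩ hij ↦ ?_
    rw [n.choose_symm_of_eq_add (Finset.HasAntidiagonal.mem_antidiagonal.1 hij).symm]

lemma vanishing_step (d : A →ₗ[ℂ] A) (hd : ∀ a x : A, d (a * x) = d a * x + a * d x)
    (φ : A →L[ℂ] ℂ) (hφ : IsMulFunctional φ) (a x : A) (ha : φ a = 0) (n : ℕ)
    (hx : ∀ k < n, φ (d^[k] x) = 0) :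
    (∀ k < n + 1, φ (d^[k] (a * x)) = 0) ∧
      φ (d^[n + 1] (a * x)) = (n + 1) * φ (d a) * φ (d^[n] x) := by
  have key : ∀ k, φ (d^[k] (a * x)) = ∑ ij ∈ Finset.HasAntidiagonal.antidiagonal k,
      (k.choose ij.1 : ℂ) * (φ (d^[ij.1] a) * φ (d^[ij.2] x)) := by
    intro k
    rw [leibniz_iterate d hd, map_sum]
    refine Finset.sum_congr rfl fun ij _ => ?_
    rw [map_nsmul, hφ, nsmul_eq_mul]
  constructor
  · intro k hk
    rw [key]
    refine Finset.sum_eq_zero fun ij hij => ?_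
    rw [Finset.HasAntidiagonal.mem_antidiagonal] at hij
    by_cases h0 : ij.1 = 0
    · rw [h0, Function.iterate_zero, id, ha]; simp
    · rw [hx ij.2 (by omega)]; simp
  · rw [key, Finset.sum_eq_single (1, n)]
    · simp [mul_assoc]
    · rintro ⟨i, j⟩ hij hne
      rw [Finset.HasAntidiagonal.mem_antidiagonal] at hij
      simp only at hij
      by_cases h0 : i = 0
      · simp [h0, ha]
      · by_cases h1 : i = 1
        · exact absurd (Prod.ext h1 (by simp only; omega)) hne
        · rw [hx j (by omega)]; simp
    · intro h
      exact absurd (Finset.HasAntidiagonal.mem_antidiagonal.2 (by simp only; omega)) h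

lemma derivation_maps_to_kernel [CompleteSpace A] (d : A →ₗ[ℂ] A)
    (hd : ∀ a x : A, d (a * x) = d a * x + a * d x)
    (hN : ∀ x : A, (∀ φ : A →L[ℂ] ℂ, IsMulFunctional φ → φ x = 0) →
      ∀ φ : A →L[ℂ] ℂ, IsMulFunctional φ → φ (d x) = 0)
    (φ : A →L[ℂ] ℂ) (hφ : IsMulFunctional φ) (a : A) : φ (d a) = 0 := by
  let N : Submodule ℂ A := ⨅ ψ : {ψ : A →L[ℂ] ℂ // IsMulFunctional ψ},
    LinearMap.ker (ψ.1 : A →ₗ[ℂ] ℂ)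
  have hNm : ∀ x, x ∈ N ↔ ∀ ψ : A →L[ℂ] ℂ, IsMulFunctional ψ → ψ x = 0 := by
    intro x
    simp only [N, Submodule.mem_iInf, LinearMap.mem_ker, Subtype.forall]
    rfl
  have hNc : IsClosed (N : Set A) := by
    have : (N : Set A) = ⋂ ψ : {ψ : A →L[ℂ] ℂ // IsMulFunctional ψ}, {x | ψ.1 x = 0} := by
      ext x
      simp only [SetLike.mem_coe, hNm, Set.mem_iInter, Set.mem_ofPred_eq, Subtype.forall]
    rw [this]
    exact isClosed_iInter fun ψ => isClosed_eq ψ.1.continuous continuous_const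
  clear_value N
  have hdN : N ≤ N.comap d := fun x hx => (hNm _).2 (hN x ((hNm x).1 hx))
  let G : (A ⧸ N) →ₗ[ℂ] (A ⧸ N) := N.mapQ N d hdN
  have hG : ∀ x : A, G (N.mkQ x) = N.mkQ (d x) := fun x => rfl
  have lift : ∀ ψ : A →ₗ[ℂ] ℂ, (∀ x ∈ N, ψ x = 0) → Continuous ψ →
      ∃ χ : (A ⧸ N) →L[ℂ] ℂ, ∀ x, χ (N.mkQ x) = ψ x := by
    intro ψ h hc
    exact ⟨⟨N.liftQ ψ h, N.isQuotientMap_mkQ.continuous_iff.2 hc⟩, fun x => rfl⟩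
  have hGc : Continuous G := by
    apply LinearMap.continuous_of_seq_closed_graph
    intro u x y hu hGu
    obtain ⟨x, rfl⟩ := N.mkQ_surjective x
    obtain ⟨y, rfl⟩ := N.mkQ_surjective y
    rw [hG, ← sub_eq_zero, ← map_sub]
    refine (Submodule.Quotient.mk_eq_zero N).2 ((hNm _).2 ?_)
    refine vanish_of_vanish_continuous d hd hN _ fun ψ hψ hc => ?_
    obtain ⟨χ, hχ⟩ := lift ψ (fun x hx => (hNm x).1 hx ψ hψ) ψ.continuous
    obtain ⟨χd, hχd⟩ := lift ((ψ : A →ₗ[ℂ] ℂ) ∘ₗ d)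
      (fun x hx => hN x ((hNm x).1 hx) ψ hψ) hc
    have hχχ : ∀ z, χ (G z) = χd z := by
      intro z
      obtain ⟨z, rfl⟩ := N.mkQ_surjective z
      rw [hG, hχ, hχd]
      rfl
    have t1 := (χ.continuous.tendsto _).comp hGu
    have t2 := (χd.continuous.tendsto _).comp hu
    have t3 : χ ∘ (G ∘ u) = χd ∘ u := by
      funext n
      exact hχχ (u n)
    rw [t3] at t1
    have t4 := tendsto_nhds_unique t1 t2
    rw [hχ, hχd] at t4
    rw [map_sub, sub_eq_zero]
    exact t4
  let Gc : (A ⧸ N) →L[ℂ] (A ⧸ N) := ⟨G, hGc⟩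
  obtain ⟨χ, hχ⟩ := lift φ (fun x hx => (hNm x).1 hx φ hφ) φ.continuous
  have hit : ∀ n x, φ (d^[n] x) = χ (Gc^[n] (N.mkQ x)) := by
    intro n x
    have : ∀ n, Gc^[n] (N.mkQ x) = N.mkQ (d^[n] x) := by
      intro n
      induction n with
      | zero => rfl
      | succ n ih => rw [Function.iterate_succ_apply', ih, Function.iterate_succ_apply']; rfl
    rw [this, hχ]
    rfl
  have hbound : ∀ n x, ‖φ (d^[n] x)‖ ≤ ‖χ‖ * (‖Gc‖ ^ n * ‖x‖) := by
    intro n x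
    rw [hit]
    refine χ.le_opNorm_of_le ?_
    induction n with
    | zero => simpa using Submodule.Quotient.norm_mk_le N x
    | succ n ih =>
      rw [Function.iterate_succ_apply', pow_succ', mul_assoc]
      exact Gc.le_opNorm_of_le ih
  -- elements of the kernel of `φ`
  have hker : ∀ a, φ a = 0 → φ (d a) = 0 := by
    intro a ha
    by_contra hne
    let p : ℕ → A := fun n => Nat.rec a (fun _ x => a * x) n
    have hp0 : p 0 = a := rfl
    have hps : ∀ n, p (n + 1) = a * p n := fun _ => rfl
    have hpn : ∀ n, ‖p n‖ ≤ ‖a‖ ^ (n + 1) := by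
      intro n
      induction n with
      | zero => simp [hp0]
      | succ n ih =>
        rw [hps, pow_succ']
        exact (norm_mul_le _ _).trans (mul_le_mul_of_nonneg_left ih (norm_nonneg _))
    have hpφ : ∀ n, (∀ k < n + 1, φ (d^[k] (p n)) = 0) ∧
        φ (d^[n + 1] (p n)) = ((n + 1).factorial : ℂ) * φ (d a) ^ (n + 1) := by
      intro n
      induction n with
      | zero =>
        refine ⟨fun k hk => ?_, by simp [hp0]⟩
        obtain rfl : k = 0 := by omega
        simpa [hp0] using ha
      | succ n ih =>
        obtain ⟨h1, h2⟩ := vanishing_step d hd φ hφ a (p n) ha (n + 1) ih.1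
        refine ⟨h1, ?_⟩
        rw [hps, h2, ih.2, Nat.factorial_succ (n + 1)]
        push_cast
        ring
    set q : ℝ := ‖φ (d a)‖ with hq
    have hqpos : 0 < q := norm_pos_iff.2 hne
    have hlim := FloorSemiring.tendsto_pow_div_factorial_atTop (‖Gc‖ * ‖a‖ / q)
    have hlim2 := ((Filter.tendsto_add_atTop_iff_nat 1).2 hlim).const_mul ‖χ‖
    rw [mul_zero] at hlim2
    have hge : ∀ n : ℕ, (1 : ℝ) ≤ ‖χ‖ *
        ((‖Gc‖ * ‖a‖ / q) ^ (n + 1) / ((n + 1).factorial : ℝ)) := by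
      intro n
      have h1 := hbound (n + 1) (p n)
      rw [(hpφ n).2, norm_mul, norm_pow, ← hq, Complex.norm_natCast] at h1
      have h2 : ‖χ‖ * (‖Gc‖ ^ (n + 1) * ‖p n‖) ≤ ‖χ‖ * (‖Gc‖ ^ (n + 1) * ‖a‖ ^ (n + 1)) := by
        have := hpn n
        gcongr
      have hf : (0 : ℝ) < ((n + 1).factorial : ℝ) := by positivity
      have hqp : 0 < q ^ (n + 1) := pow_pos hqpos _
      rw [div_pow, mul_pow, div_div, ← mul_div_assoc, le_div_iff₀ (mul_pos hqp hf)]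
      linarith
    have := ge_of_tendsto' hlim2 hge
    linarith
  -- the general case
  by_cases ha : φ a = 0
  · exact hker a ha
  · let u := (φ a)⁻¹ • a
    have hu : φ u = 1 := by
      change φ ((φ a)⁻¹ • a) = 1
      rw [map_smul, smul_eq_mul, inv_mul_cancel₀ ha]
    have h1 := hker (u * u - u) (by rw [map_sub, hφ, hu]; ring)
    rw [map_sub, hd, map_sub, map_add, hφ, hφ, hu] at h1
    have h2 : φ (d u) = 0 := by linear_combination h1
    change φ (d ((φ a)⁻¹ • a)) = 0 at h2
    rw [map_smul, map_smul, smul_eq_mul] at h2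
    exact (mul_eq_zero.1 h2).resolve_left (inv_ne_zero ha)

end Helpers

/-- Let `A` be a complex Banach algebra such that the quotient `A / ran(A)`
by the right annihilator is commutative and semisimple (its Jacobson radical is zero; for the
possibly non-unital ring `A / ran(A)` this means that the only element whose image in the
unitization lies in the Jacobson radical of the unitization is `0`).  Then every derivation
of `A` maps `A` into `ran(A)`, and `ran(A)` is contained in the Jacobson radical of `A`. -/
theorem derivation_range_subset_rightAnnihilator_and_ran_subset_radical
    {A : Type*} [NonUnitalNormedRing A] [NormedSpace ℂ A]
    [IsScalarTower ℂ A A] [SMulCommClass ℂ A A] [CompleteSpace A]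
    (hcomm : ∀ x y : RanQuot A, x * y = y * x)
    (hss : ∀ x : RanQuot A,
      (↑x : Unitization ℤ (RanQuot A)) ∈ (⊥ : Ideal (Unitization ℤ (RanQuot A))).jacobson →
        x = 0)
    (d : A →ₗ[ℂ] A) (hd : ∀ a x : A, d (a * x) = d a * x + a * d x) :
    (∀ a x : A, x * d a = 0) ∧
      (∀ r : A, (∀ a : A, a * r = 0) →
        (↑r : Unitization ℂ A) ∈ (⊥ : Ideal (Unitization ℂ A)).jacobson) := by
  have hran := mem_ran_of_functionals hcomm hss
  refine ⟨fun a x => ?_, fun r hr => ran_mem_jacobson r hr⟩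
  refine hran (d a) (fun φ hφ => derivation_maps_to_kernel d hd ?_ φ hφ a) x
  intro y hy ψ hψ
  have h1 := hran y hy
  have h2 : ∀ z : A, z * d y = 0 := by
    intro z
    have h3 := hd z y
    rw [h1 z, h1 (d z), map_zero, zero_add] at h3
    exact h3.symm
  have h4 := hψ (d y) (d y)
  rw [h2, map_zero] at h4
  exact mul_self_eq_zero.1 h4.symm
end
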